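/- arXiv:1109.5202 — 6 statements merged into one kernel-verified Lean document; each statement's English description precedes it below -/
import Mathlib

section
/- Fix a partition μ = (μ₁,…,μᵣ) of n with r parts. Then for every partition λ of n, μ₁·n(λ) − n·v(λ,μ) ≤ μ₁·n(n−1)/2 − n·(‖μ‖² − n)/2, i.e. the maximum of μ₁·n(λ) − n·v(λ,μ) over λ ∈ 𝒫ₙ is attained at λ = (1ⁿ). Moreover this maximum is attained only at λ = (1ⁿ), unless μ is rectangular, say μ = (t^{n/t}) for some t dividing n, in which case it is attained exactly at those λ that are the union of n/t copies of a single partition λ₀ of t. -/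
/-- A partition of `n`: a weakly decreasing, eventually zero sequence of natural
numbers (0-indexed: `parts i` is `λ_{i+1}`) summing to `n`. -/
structure PartitionOf (n : ℕ) where
  parts : ℕ → ℕ
  antitone : ∀ ⦃i j : ℕ⦄, i ≤ j → parts j ≤ parts i
  eventually_zero : ∃ N, ∀ i, N ≤ i → parts i = 0
  sum_eq : ∑ᶠ i, parts i = n

/-- A partition is rectangular if all its (non-zero) parts are equal. -/
def Rectangular {n : ℕ} (lam : PartitionOf n) : Prop :=
  ∀ i j, lam.parts i ≠ 0 → lam.parts j ≠ 0 → lam.parts i = lam.parts j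

/-- The length (number of non-zero parts) of a partition. -/
noncomputable def partLength {n : ℕ} (lam : PartitionOf n) : ℕ :=
  Set.ncard {i | lam.parts i ≠ 0}

/-- `n(λ) = Σ_{i ≥ 1} (i-1)·λ_i` (here 0-indexed, so `Σ_i i·parts i`). -/
noncomputable def nStat {n : ℕ} (lam : PartitionOf n) : ℕ := ∑ᶠ i, i * lam.parts i

/-- The partition `(1ⁿ)` of `n`. -/
def onesPartition (n : ℕ) : PartitionOf n where
  parts i := if i < n then 1 else 0
  antitone := by
    intro i j hij
    by_cases h : j < n
    · simp [h, lt_of_le_of_lt hij h]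
    · simp [h]
  eventually_zero := ⟨n, fun i hi => if_neg (by omega)⟩
  sum_eq := by
    have hsupp : (Function.support fun i => if i < n then 1 else 0) ⊆
        (Finset.range n : Finset ℕ) := by
      intro i hi
      simp only [Function.mem_support, ne_eq, ite_eq_right_iff, not_forall] at hi
      exact Finset.mem_range.mpr hi.1
    rw [finsum_eq_sum_of_support_subset _ hsupp]
    rw [Finset.sum_ite_of_true (by intro i hi; exact Finset.mem_range.mp hi)]
    simp

/-- `ν` is the union of the family of partitions `ρ` (multiset of parts of `ν` is the
disjoint union of those of the `ρ p`), expressed by counting parts of each value. -/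
def IsUnionOf {s : ℕ} {m : Fin s → ℕ} (ρ : ∀ p, PartitionOf (m p)) {n : ℕ}
    (ν : PartitionOf n) : Prop :=
  ∀ v, 0 < v →
    Set.ncard {i | ν.parts i = v} = ∑ p, Set.ncard {i | (ρ p).parts i = v}

/-- `v(λ,μ) = min { n(ρ¹)+⋯+n(ρʳ) : ρᵖ ∈ 𝒫_{μ_p}, ρ¹∪⋯∪ρʳ ⊴ λ }`, where `r` is the
number of parts of `μ`. -/
noncomputable def vStat {n : ℕ} (r : ℕ) (μ lam : PartitionOf n) : ℕ :=
  sInf {t | ∃ ρ : ∀ p : Fin r, PartitionOf (μ.parts p),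
    (∃ νu : PartitionOf n, IsUnionOf ρ νu ∧
      ∀ j, ∑ i ∈ Finset.range j, νu.parts i ≤ ∑ i ∈ Finset.range j, lam.parts i) ∧
    ∑ p, nStat (ρ p) = t}

/-- `f(λ) = μ₁·n(λ) − n·v(λ,μ)`. -/
noncomputable def fVal {n : ℕ} (r : ℕ) (μ lam : PartitionOf n) : ℚ :=
  (μ.parts 0 : ℚ) * (nStat lam : ℚ) - (n : ℚ) * (vStat r μ lam : ℚ)

/-- `M = μ₁·n(n−1)/2 − n·(‖μ‖²−n)/2`, the value of `f` at `(1ⁿ)`. -/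
noncomputable def MVal {n : ℕ} (μ : PartitionOf n) : ℚ :=
  (μ.parts 0 : ℚ) * ((n : ℚ) * ((n : ℚ) - 1) / 2)
    - (n : ℚ) * ((((∑ᶠ i, (μ.parts i) ^ 2 : ℕ) : ℚ) - (n : ℚ)) / 2)

namespace PartitionOf

variable {n : ℕ}

lemma finite_support (lam : PartitionOf n) : (Function.support lam.parts).Finite := by
  obtain ⟨N, hN⟩ := lam.eventually_zero
  refine (Finset.range N).finite_toSet.subset fun i hi => ?_
  by_contra h
  exact hi (hN i (by simpa using h))

lemma sum_range_le (lam : PartitionOf n) (k : ℕ) : ∑ i ∈ Finset.range k, lam.parts i ≤ n := by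
  refine le_trans (Finset.sum_le_sum_of_subset Finset.subset_union_right)
    ((finsum_eq_sum_of_support_subset (s := lam.finite_support.toFinset ∪ Finset.range k) _
      fun i hi => ?_).symm.trans lam.sum_eq).le
  simp [Function.mem_support.mp hi]

lemma parts_eq_zero (lam : PartitionOf n) {i : ℕ} (hi : n ≤ i) : lam.parts i = 0 := by
  by_contra h
  have h1 : ∑ _j ∈ Finset.range (i + 1), 1 ≤ ∑ j ∈ Finset.range (i + 1), lam.parts j :=
    Finset.sum_le_sum fun j hj => (Nat.one_le_iff_ne_zero.mpr h).trans
      (lam.antitone (Nat.lt_succ_iff.mp (Finset.mem_range.mp hj)))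
  have h2 := lam.sum_range_le (i + 1)
  simp only [Finset.sum_const, Finset.card_range, smul_eq_mul, mul_one] at h1
  omega

lemma parts_le (lam : PartitionOf n) (i : ℕ) : lam.parts i ≤ n :=
  (Finset.single_le_sum (f := lam.parts) (fun _ _ => Nat.zero_le _)
    (Finset.self_mem_range_succ i)).trans (lam.sum_range_le (i + 1))

lemma finsum_eq_sum_range (lam : PartitionOf n) {g : ℕ → ℕ} {N : ℕ} (hN : n ≤ N)
    (hg : ∀ i, lam.parts i = 0 → g i = 0) : ∑ᶠ i, g i = ∑ i ∈ Finset.range N, g i := by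
  refine finsum_eq_sum_of_support_subset _ fun i hi => ?_
  by_contra h
  exact hi (hg i (lam.parts_eq_zero (hN.trans (by simpa using h))))

lemma sum_range_eq (lam : PartitionOf n) {N : ℕ} (hN : n ≤ N) :
    ∑ i ∈ Finset.range N, lam.parts i = n := by
  rw [← lam.finsum_eq_sum_range hN fun _ h => h, lam.sum_eq]

lemma parts_zero_pos (lam : PartitionOf n) (hn : 1 ≤ n) : 0 < lam.parts 0 := by
  refine Nat.pos_of_ne_zero fun h => ?_
  have h1 := lam.sum_range_eq le_rfl
  rw [Finset.sum_eq_zero fun i _ => by have := lam.antitone (Nat.zero_le i); omega] at h1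
  omega

lemma nStat_eq_sum_range (lam : PartitionOf n) {N : ℕ} (hN : n ≤ N) :
    nStat lam = ∑ i ∈ Finset.range N, i * lam.parts i :=
  lam.finsum_eq_sum_range hN fun i h => by simp [h]

/-- The parts of the conjugate partition: `conj j` is the number of parts larger than `j`. -/
noncomputable def conj (lam : PartitionOf n) (j : ℕ) : ℕ := Set.ncard {i | j < lam.parts i}

lemma lt_conj_iff (lam : PartitionOf n) {i j : ℕ} : i < lam.conj j ↔ j < lam.parts i := by
  classical
  have hex : ∃ k, lam.parts k ≤ j := ⟨n, by simp [lam.parts_eq_zero le_rfl]⟩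
  have hset : {i | j < lam.parts i} = (Finset.range (Nat.find hex) : Set ℕ) := by
    ext k
    simp only [Set.mem_ofPred_eq, Finset.coe_range, Set.mem_Iio, Nat.lt_find_iff, not_le]
    exact ⟨fun h m hm => h.trans_le (lam.antitone hm), fun h => h k le_rfl⟩
  have hc : lam.conj j = Nat.find hex := by
    rw [conj, hset, Set.ncard_coe_finset, Finset.card_range]
  rw [hc, ← Finset.mem_range, ← Finset.mem_coe, ← hset, Set.mem_ofPred_eq]

lemma conj_le (lam : PartitionOf n) (j : ℕ) : lam.conj j ≤ n := by
  by_contra! h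
  have := lam.lt_conj_iff.mp h
  simp [lam.parts_eq_zero le_rfl] at this

lemma conj_eq_zero (lam : PartitionOf n) {j : ℕ} (hj : n ≤ j) : lam.conj j = 0 := by
  by_contra h
  have := lam.lt_conj_iff.mp (Nat.pos_of_ne_zero h)
  have := lam.parts_le 0
  omega

lemma conj_eq_ncard_add_conj (lam : PartitionOf n) (j : ℕ) :
    lam.conj j = Set.ncard {i | lam.parts i = j + 1} + lam.conj (j + 1) := by
  have hset : {i | lam.parts i = j + 1}
      = (Finset.Ico (lam.conj (j + 1)) (lam.conj j) : Set ℕ) := by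
    ext k
    have h1 := lam.lt_conj_iff (i := k) (j := j)
    have h2 := lam.lt_conj_iff (i := k) (j := j + 1)
    simp only [Set.mem_ofPred_eq, Finset.coe_Ico, Set.mem_Ico]
    omega
  have hle : lam.conj (j + 1) ≤ lam.conj j := by
    by_contra! h
    have h1 := lam.lt_conj_iff.mp h
    exact lt_irrefl _ (lam.lt_conj_iff.mpr ((Nat.lt_succ_self j).trans h1))
  rw [hset, Set.ncard_coe_finset, Nat.card_Ico, Nat.sub_add_cancel hle]

lemma sum_mul_parts (lam : PartitionOf n) {N : ℕ} (hN : n ≤ N) (g : ℕ → ℕ) :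
    ∑ i ∈ Finset.range N, g i * lam.parts i
      = ∑ j ∈ Finset.range N, ∑ i ∈ Finset.range (lam.conj j), g i := by
  have h1 : ∀ i ∈ Finset.range N, g i * lam.parts i
      = ∑ j ∈ Finset.range N, if j < lam.parts i then g i else 0 := by
    intro i _
    rw [← Finset.sum_filter, Finset.sum_const, smul_eq_mul, mul_comm]
    have : (Finset.range N).filter (· < lam.parts i) = Finset.range (lam.parts i) := by
      ext j
      have := lam.parts_le i
      simp only [Finset.mem_filter, Finset.mem_range]
      omega
    rw [this, Finset.card_range]
  rw [Finset.sum_congr rfl h1, Finset.sum_comm]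
  refine Finset.sum_congr rfl fun j _ => ?_
  rw [← Finset.sum_filter]
  refine Finset.sum_congr ?_ fun _ _ => rfl
  ext i
  have := lam.conj_le j
  simp only [Finset.mem_filter, Finset.mem_range, ← lam.lt_conj_iff]
  omega

lemma sum_conj (lam : PartitionOf n) {N : ℕ} (hN : n ≤ N) :
    ∑ j ∈ Finset.range N, lam.conj j = n := by
  have := lam.sum_mul_parts hN fun _ => 1
  simp only [one_mul, Finset.sum_const, Finset.card_range, smul_eq_mul, mul_one] at this
  rw [← this, lam.sum_range_eq hN]

lemma sum_conj_sq (lam : PartitionOf n) {N : ℕ} (hN : n ≤ N) :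
    ∑ j ∈ Finset.range N, lam.conj j ^ 2 = 2 * nStat lam + n := by
  have h := lam.sum_mul_parts hN fun i => 2 * i + 1
  have hsq : ∀ c : ℕ, ∑ i ∈ Finset.range c, (2 * i + 1) = c ^ 2 := by
    intro c
    induction c with
    | zero => simp
    | succ c ih => rw [Finset.sum_range_succ, ih]; ring
  simp only [hsq] at h
  rw [← h, lam.nStat_eq_sum_range hN, Finset.mul_sum]
  nth_rewrite 3 [← lam.sum_range_eq hN]
  rw [← Finset.sum_add_distrib]
  exact Finset.sum_congr rfl fun i _ => by ring

lemma sum_partialSums (lam : PartitionOf n) :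
    ∑ j ∈ Finset.range (n + 1), ∑ i ∈ Finset.range j, lam.parts i + nStat lam = n * n := by
  have key : ∀ N, ∑ j ∈ Finset.range (N + 1), ∑ i ∈ Finset.range j, lam.parts i
      + ∑ i ∈ Finset.range N, i * lam.parts i = N * ∑ i ∈ Finset.range N, lam.parts i := by
    intro N
    induction N with
    | zero => simp
    | succ N ih =>
      rw [Finset.sum_range_succ, Finset.sum_range_succ (fun i => i * lam.parts i)]
      rw [Finset.sum_range_succ (fun i => lam.parts i)]
      linarith
  rw [lam.nStat_eq_sum_range le_rfl, key, lam.sum_range_eq le_rfl]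

lemma nStat_le_of_dominated {nu lam : PartitionOf n}
    (h : ∀ j, ∑ i ∈ Finset.range j, nu.parts i ≤ ∑ i ∈ Finset.range j, lam.parts i) :
    nStat lam ≤ nStat nu := by
  have h1 := nu.sum_partialSums
  have h2 := lam.sum_partialSums
  have h3 := Finset.sum_le_sum fun j (_ : j ∈ Finset.range (n + 1)) => h j
  omega

lemma parts_eq_of_dominated {nu lam : PartitionOf n}
    (h : ∀ j, ∑ i ∈ Finset.range j, nu.parts i ≤ ∑ i ∈ Finset.range j, lam.parts i)
    (heq : nStat nu = nStat lam) : nu.parts = lam.parts := by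
  have h1 := nu.sum_partialSums
  have h2 := lam.sum_partialSums
  have h3 := (Finset.sum_eq_sum_iff_of_le
    fun j (_ : j ∈ Finset.range (n + 1)) => h j).mp (by omega)
  funext i
  by_cases hi : i < n
  · have h4 := h3 i (by simp; omega)
    have h5 := h3 (i + 1) (by simp; omega)
    rw [Finset.sum_range_succ, Finset.sum_range_succ] at h5
    omega
  · rw [nu.parts_eq_zero (by omega), lam.parts_eq_zero (by omega)]

lemma conj_eq_sum_of_isUnionOf {s : ℕ} {m : Fin s → ℕ} {ρ : ∀ p, PartitionOf (m p)}
    {nu : PartitionOf n} (h : IsUnionOf ρ nu) (hm : ∀ p, m p ≤ n) (j : ℕ) :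
    nu.conj j = ∑ p, (ρ p).conj j := by
  suffices ∀ k j, n ≤ j + k → nu.conj j = ∑ p, (ρ p).conj j from this n j (by omega)
  intro k
  induction k with
  | zero =>
    intro j hj
    rw [add_zero] at hj
    rw [nu.conj_eq_zero hj, Finset.sum_eq_zero fun p _ => (ρ p).conj_eq_zero ((hm p).trans hj)]
  | succ k ih =>
    intro j hj
    rw [nu.conj_eq_ncard_add_conj, ih (j + 1) (by omega), h (j + 1) (by omega),
      ← Finset.sum_add_distrib]
    exact Finset.sum_congr rfl fun p _ => ((ρ p).conj_eq_ncard_add_conj j).symm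

lemma two_mul_nStat_ones (n : ℕ) : 2 * nStat (onesPartition n) + n = n ^ 2 := by
  have h : nStat (onesPartition n) = ∑ i ∈ Finset.range n, i := by
    rw [nStat_eq_sum_range _ le_rfl]
    exact Finset.sum_congr rfl fun i hi => by simp [onesPartition, Finset.mem_range.mp hi]
  have := Finset.sum_range_id_mul_two n
  rw [h]
  cases n with
  | zero => simp
  | succ k => simp only [Nat.add_sub_cancel] at this; nlinarith

lemma ones_dominated (lam : PartitionOf n) (j : ℕ) :
    ∑ i ∈ Finset.range j, (onesPartition n).parts i ≤ ∑ i ∈ Finset.range j, lam.parts i := by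
  by_cases hz : ∃ k < j, lam.parts k = 0
  · obtain ⟨k, hk, hk0⟩ := hz
    have h : ∑ᶠ i, lam.parts i = ∑ i ∈ Finset.range j, lam.parts i := by
      refine finsum_eq_sum_of_support_subset _ fun i hi => ?_
      by_contra h
      have := lam.antitone (show k ≤ i by simp at h; omega)
      exact hi (by omega)
    rw [← h, lam.sum_eq]
    exact (onesPartition n).sum_range_le j
  · push Not at hz
    refine Finset.sum_le_sum fun i hi => ?_
    have := hz i (Finset.mem_range.mp hi)
    simp only [onesPartition]
    split <;> omega

lemma ncard_ones (n v : ℕ) (hv : 0 < v) :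
    Set.ncard {i | (onesPartition n).parts i = v} = if v = 1 then n else 0 := by
  split_ifs with h
  · have : {i | (onesPartition n).parts i = v} = (Finset.range n : Set ℕ) := by
      ext i
      simp [onesPartition, h]
    rw [this, Set.ncard_coe_finset, Finset.card_range]
  · have : {i | (onesPartition n).parts i = v} = ∅ := by
      ext i
      simp only [onesPartition, Set.mem_ofPred_eq, Set.mem_empty_iff_false, iff_false]
      split <;> omega
    rw [this, Set.ncard_empty]

lemma isUnionOf_ones {s : ℕ} {m : Fin s → ℕ} (hm : ∑ p, m p = n) :
    IsUnionOf (fun p => onesPartition (m p)) (onesPartition n) := by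
  intro v hv
  simp only [ncard_ones _ v hv]
  split_ifs <;> simp [hm]

lemma parts_ne_zero_iff (mu : PartitionOf n) {i : ℕ} :
    mu.parts i ≠ 0 ↔ i < partLength mu := by
  have : partLength mu = mu.conj 0 := by
    simp only [partLength, conj, Nat.pos_iff_ne_zero]
  rw [this, lt_conj_iff, Nat.pos_iff_ne_zero]

lemma finsum_eq_sum_fin (mu : PartitionOf n) {r : ℕ} (hr : partLength mu = r) {g : ℕ → ℕ}
    (hg : ∀ i, mu.parts i = 0 → g i = 0) : ∑ᶠ i, g i = ∑ p : Fin r, g p := by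
  rw [← Finset.sum_range]
  refine finsum_eq_sum_of_support_subset _ fun i hi => ?_
  by_contra h
  refine hi (hg i ?_)
  by_contra h0
  exact h (by simpa [hr] using mu.parts_ne_zero_iff.mp h0)

lemma sum_fin_eq (mu : PartitionOf n) {r : ℕ} (hr : partLength mu = r) :
    ∑ p : Fin r, mu.parts p = n := by
  rw [← mu.finsum_eq_sum_fin hr fun _ h => h, mu.sum_eq]

end PartitionOf

/-- The sum-of-squares expression for the slack in the main inequality, for a matrix `x` and row
weights `m` of total weight `N`. -/
lemma slack_eq_sum {ι κ : Type*} [Fintype ι] (s : Finset κ) (x : ι → κ → ℚ) (m : ι → ℚ)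
    (t N : ℚ) (hm : ∀ p, m p ≠ 0) (hN : ∑ p, m p = N) (hN0 : N ≠ 0) :
    t * N ^ 2 - N * ∑ p, m p ^ 2 - (t * ∑ j ∈ s, (∑ p, x p j) ^ 2 - N * ∑ p, ∑ j ∈ s, x p j ^ 2)
      = ∑ j ∈ s, ∑ p, t * (N / m p) * (x p j - m p * (∑ q, x q j) / N) ^ 2
        + ∑ p, N * ((t - m p) / m p) * (m p ^ 2 - ∑ j ∈ s, x p j ^ 2) := by
  have h1 : ∀ j, ∑ p, t * (N / m p) * (x p j - m p * (∑ q, x q j) / N) ^ 2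
      = ∑ p, t * N * (x p j ^ 2 / m p) - t * (∑ p, x p j) ^ 2 := by
    intro j
    set c := ∑ q, x q j with hc
    have : ∀ p, t * (N / m p) * (x p j - m p * c / N) ^ 2
        = t * N * (x p j ^ 2 / m p) - 2 * t * c * x p j + t * c ^ 2 / N * m p := by
      intro p
      have := hm p
      field_simp
      ring
    simp only [this, Finset.sum_add_distrib, Finset.sum_sub_distrib]
    rw [← Finset.mul_sum _ _ (2 * t * c), ← hc, ← Finset.mul_sum _ _ (t * c ^ 2 / N), hN]
    field_simp
    ring
  have h2 : ∀ p, N * ((t - m p) / m p) * (m p ^ 2 - ∑ j ∈ s, x p j ^ 2)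
      = t * N * m p - N * m p ^ 2 + N * ∑ j ∈ s, x p j ^ 2
        - ∑ j ∈ s, t * N * (x p j ^ 2 / m p) := by
    intro p
    have := hm p
    rw [← Finset.mul_sum, ← Finset.sum_div]
    field_simp
    ring
  simp only [h1, h2, Finset.sum_add_distrib, Finset.sum_sub_distrib]
  rw [Finset.sum_comm (s := s), ← Finset.mul_sum _ _ (t * N), hN, ← Finset.mul_sum _ _ N,
    ← Finset.mul_sum _ _ N, ← Finset.mul_sum _ _ t]
  ring

section Union

variable {n r : ℕ} {μ : PartitionOf n} {ρ : ∀ p : Fin r, PartitionOf (μ.parts p)}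
  {ν : PartitionOf n}

/-- The value of `μ₁·n(ν) − n·Σ n(ρᵖ)` for a union `ν` of the `ρᵖ` is at most `MVal μ`; equality
forces all `ρᵖ` to have proportional conjugates, and the short ones to have a single column. -/
lemma le_MVal_and_of_eq (hn : 1 ≤ n) (hr : partLength μ = r) (hρ : IsUnionOf ρ ν) :
    (μ.parts 0 : ℚ) * nStat ν - n * (∑ p, nStat (ρ p) : ℕ) ≤ MVal μ ∧
    ((μ.parts 0 : ℚ) * nStat ν - n * (∑ p, nStat (ρ p) : ℕ) = MVal μ →
      (∀ p j, n * (ρ p).conj j = μ.parts p * ν.conj j) ∧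
      ∀ p : Fin r, μ.parts p ≠ μ.parts 0 →
        μ.parts p ^ 2 = ∑ j ∈ Finset.range n, (ρ p).conj j ^ 2) := by
  have hpos : ∀ p : Fin r, 0 < μ.parts p := fun p =>
    Nat.pos_of_ne_zero (μ.parts_ne_zero_iff.mpr (hr ▸ p.2))
  have hle : ∀ p : Fin r, μ.parts p ≤ n := fun p => μ.parts_le p
  have hle0 : ∀ p : Fin r, μ.parts p ≤ μ.parts 0 := fun p => μ.antitone (Nat.zero_le _)
  have h0 := μ.parts_zero_pos hn
  have hcol := fun j => PartitionOf.conj_eq_sum_of_isUnionOf hρ hle j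
  have hslack := slack_eq_sum (Finset.range n) (fun p j => ((ρ p).conj j : ℚ))
    (fun p : Fin r => (μ.parts p : ℚ)) (μ.parts 0) n (fun p => by exact_mod_cast (hpos p).ne')
    (by exact_mod_cast μ.sum_fin_eq hr)
    (by positivity)
  simp only [← Nat.cast_sum, ← Nat.cast_pow, ← hcol] at hslack
  rw [ν.sum_conj_sq le_rfl] at hslack
  simp only [(ρ _).sum_conj_sq (hle _)] at hslack
  have hsq : ∑ᶠ i, μ.parts i ^ 2 = ∑ p : Fin r, μ.parts p ^ 2 :=
    μ.finsum_eq_sum_fin hr fun i h => by simp [h]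
  have hsum := μ.sum_fin_eq hr
  rw [Finset.sum_add_distrib, hsum, ← Finset.mul_sum] at hslack
  have hA : ∀ j ∈ Finset.range n, ∀ p ∈ (Finset.univ : Finset (Fin r)),
      (0 : ℚ) ≤ μ.parts 0 * (n / μ.parts p) * ((ρ p).conj j - μ.parts p * ν.conj j / n) ^ 2 := fun j _ p _ => by positivity
  have hxle : ∀ p, 2 * nStat (ρ p) + μ.parts p ≤ μ.parts p ^ 2 := fun p => by
    have h1 := PartitionOf.nStat_le_of_dominated (ρ p).ones_dominated
    have h2 := PartitionOf.two_mul_nStat_ones (μ.parts p)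
    omega
  have hB : ∀ p ∈ (Finset.univ : Finset (Fin r)),
      (0 : ℚ) ≤ n * ((μ.parts 0 - μ.parts p) / μ.parts p) *
      ((μ.parts p ^ 2 : ℕ) - (2 * nStat (ρ p) + μ.parts p : ℕ)) := fun p _ => by
    have h1 : (0 : ℚ) ≤ μ.parts 0 - μ.parts p := sub_nonneg.mpr (by exact_mod_cast hle0 p)
    have h2 : (0 : ℚ) ≤ (μ.parts p ^ 2 : ℕ) - (2 * nStat (ρ p) + μ.parts p : ℕ) :=
      sub_nonneg.mpr (by exact_mod_cast hxle p)
    positivity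
  have hA' := Finset.sum_nonneg fun j hj => Finset.sum_nonneg (hA j hj)
  have hB' := Finset.sum_nonneg hB
  have hM : 2 * (MVal μ - ((μ.parts 0 : ℚ) * nStat ν - n * (∑ p, nStat (ρ p) : ℕ))) = _ :=
    Eq.trans (by rw [MVal, hsq]; push_cast; ring) hslack
  refine ⟨by linarith, fun heq => ?_⟩
  rw [heq, sub_self, mul_zero] at hM
  have hn0 : (n : ℚ) ≠ 0 := by positivity
  constructor
  · intro p j
    by_cases hj : j < n
    · have h1 := (Finset.sum_eq_zero_iff_of_nonneg fun j hj => Finset.sum_nonneg (hA j hj)).mp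
        (by linarith) j (Finset.mem_range.mpr hj)
      have h2 := (Finset.sum_eq_zero_iff_of_nonneg (hA j (Finset.mem_range.mpr hj))).mp h1 p
        (Finset.mem_univ p)
      have h3 : (0 : ℚ) < μ.parts 0 * (n / μ.parts p) := by
        have := hpos p
        positivity
      have h4 := pow_eq_zero_iff (two_ne_zero) |>.mp ((mul_eq_zero.mp h2).resolve_left h3.ne')
      rw [sub_eq_zero, eq_div_iff hn0] at h4
      rw [mul_comm]
      exact_mod_cast h4
    · rw [ν.conj_eq_zero (by omega), (ρ p).conj_eq_zero (by have := hle p; omega), mul_zero,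
        mul_zero]
  · intro p hp
    have h1 := (Finset.sum_eq_zero_iff_of_nonneg hB).mp (by linarith) p (Finset.mem_univ p)
    have h2 : (n : ℚ) * ((μ.parts 0 - μ.parts p) / μ.parts p) ≠ 0 := by
      refine mul_ne_zero hn0 (div_ne_zero (sub_ne_zero.mpr ?_) ?_)
      · exact_mod_cast hp.symm
      · exact_mod_cast (hpos p).ne'
    have h3 := sub_eq_zero.mp ((mul_eq_zero.mp h1).resolve_left h2)
    rw [(ρ p).sum_conj_sq (hle p)]
    exact_mod_cast h3

end Union

lemma exists_vStat_eq {n r : ℕ} {μ : PartitionOf n} (hr : partLength μ = r)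
    (lam : PartitionOf n) :
    ∃ ρ : ∀ p : Fin r, PartitionOf (μ.parts p), ∃ ν : PartitionOf n, IsUnionOf ρ ν ∧
      (∀ j, ∑ i ∈ Finset.range j, ν.parts i ≤ ∑ i ∈ Finset.range j, lam.parts i) ∧
      ∑ p, nStat (ρ p) = vStat r μ lam := by
  obtain ⟨ρ, ⟨ν, h1, h2⟩, h3⟩ := Nat.sInf_mem (s := {t | ∃ ρ : ∀ p : Fin r,
    PartitionOf (μ.parts p), (∃ νu : PartitionOf n, IsUnionOf ρ νu ∧
      ∀ j, ∑ i ∈ Finset.range j, νu.parts i ≤ ∑ i ∈ Finset.range j, lam.parts i) ∧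
    ∑ p, nStat (ρ p) = t}) ⟨_, fun p => onesPartition (μ.parts p),
      ⟨onesPartition n, PartitionOf.isUnionOf_ones (μ.sum_fin_eq hr), lam.ones_dominated⟩, rfl⟩
  exact ⟨ρ, ν, h1, h2, h3⟩

lemma vStat_le_of_isUnionOf {n r : ℕ} {μ lam : PartitionOf n}
    {ρ : ∀ p : Fin r, PartitionOf (μ.parts p)} (h : IsUnionOf ρ lam) :
    vStat r μ lam ≤ ∑ p, nStat (ρ p) :=
  Nat.sInf_le ⟨ρ, ⟨lam, h, fun _ => le_rfl⟩, rfl⟩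

lemma fVal_le_MVal {n r : ℕ} (hn : 1 ≤ n) {μ : PartitionOf n} (hr : partLength μ = r)
    (lam : PartitionOf n) : fVal r μ lam ≤ MVal μ := by
  obtain ⟨ρ, ν, hu, hd, hv⟩ := exists_vStat_eq hr lam
  have h1 := (le_MVal_and_of_eq hn hr hu).1
  rw [hv] at h1
  refine le_trans ?_ h1
  rw [fVal]
  gcongr
  exact PartitionOf.nStat_le_of_dominated hd

/-- If `lam` attains the maximum, then it is itself a union of partitions `ρᵖ` attaining it. -/
lemma exists_isUnionOf_of_fVal_eq {n r : ℕ} (hn : 1 ≤ n) {μ : PartitionOf n}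
    (hr : partLength μ = r) (h0 : 0 < μ.parts 0) {lam : PartitionOf n}
    (h : fVal r μ lam = MVal μ) :
    ∃ ρ : ∀ p : Fin r, PartitionOf (μ.parts p), IsUnionOf ρ lam ∧
      (μ.parts 0 : ℚ) * nStat lam - n * (∑ p, nStat (ρ p) : ℕ) = MVal μ := by
  obtain ⟨ρ, ν, hu, hd, hv⟩ := exists_vStat_eq hr lam
  have h1 := (le_MVal_and_of_eq hn hr hu).1
  rw [hv, ← h, fVal, sub_le_sub_iff_right] at h1
  have h2 : nStat ν ≤ nStat lam := by
    have : (0 : ℚ) < μ.parts 0 := by exact_mod_cast h0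
    exact_mod_cast le_of_mul_le_mul_left h1 this
  have h3 := PartitionOf.parts_eq_of_dominated hd
    (le_antisymm h2 (PartitionOf.nStat_le_of_dominated hd))
  refine ⟨ρ, fun v hv' => ?_, by rw [hv, ← h, fVal]⟩
  rw [← h3]
  exact hu v hv'

lemma fVal_ones {n r : ℕ} (hn : 1 ≤ n) {μ : PartitionOf n} (hr : partLength μ = r) :
    fVal r μ (onesPartition n) = MVal μ := by
  refine le_antisymm (fVal_le_MVal hn hr _) ?_
  have h1 := vStat_le_of_isUnionOf (μ := μ) (PartitionOf.isUnionOf_ones (μ.sum_fin_eq hr))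
  have h2 : 2 * ∑ p : Fin r, nStat (onesPartition (μ.parts p)) + n
      = ∑ p : Fin r, μ.parts p ^ 2 := by
    refine (congrArg₂ (· + ·) (Finset.mul_sum _ _ _) (μ.sum_fin_eq hr).symm).trans ?_
    rw [← Finset.sum_add_distrib]
    exact Finset.sum_congr rfl fun p _ => PartitionOf.two_mul_nStat_ones _
  have hsq : ∑ᶠ i, μ.parts i ^ 2 = ∑ p : Fin r, μ.parts p ^ 2 :=
    μ.finsum_eq_sum_fin hr fun i h => by simp [h]
  have h3 := PartitionOf.two_mul_nStat_ones n
  rw [MVal, hsq, ← h2, fVal]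
  have h1' : (n : ℚ) * vStat r μ (onesPartition n)
      ≤ n * (∑ p : Fin r, nStat (onesPartition (μ.parts p)) : ℕ) := by gcongr
  have h3' : (n : ℚ) * (n - 1) / 2 = nStat (onesPartition n) := by
    have : (2 : ℚ) * nStat (onesPartition n) + n = n ^ 2 := by exact_mod_cast h3
    linarith
  rw [h3', Nat.cast_add, add_sub_cancel_right, Nat.cast_mul, Nat.cast_ofNat,
    mul_div_cancel_left₀ _ two_ne_zero]
  linarith

lemma eq_ones_of_fVal_eq {n r : ℕ} (hn : 1 ≤ n) {μ : PartitionOf n} (hr : partLength μ = r)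
    (h0 : 0 < μ.parts 0) (hμ : ¬ Rectangular μ) {lam : PartitionOf n}
    (h : fVal r μ lam = MVal μ) : lam.parts = (onesPartition n).parts := by
  obtain ⟨ρ, hu, hM⟩ := exists_isUnionOf_of_fVal_eq hn hr h0 h
  obtain ⟨hprop, hsq⟩ := (le_MVal_and_of_eq hn hr hu).2 hM
  obtain ⟨p, hp⟩ : ∃ p : Fin r, μ.parts p ≠ μ.parts 0 := by
    by_contra! hall
    refine hμ fun i j hi hj => ?_
    rw [μ.parts_ne_zero_iff, hr] at hi hj
    exact (hall ⟨i, hi⟩).trans (hall ⟨j, hj⟩).symm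
  have hpos : 0 < μ.parts p := Nat.pos_of_ne_zero (μ.parts_ne_zero_iff.mpr (hr ▸ p.2))
  have h1 : μ.parts p ^ 2 * n ^ 2
      = μ.parts p ^ 2 * ∑ j ∈ Finset.range n, lam.conj j ^ 2 := by
    rw [Finset.mul_sum, ← Finset.sum_congr rfl fun j _ => mul_pow (μ.parts p) (lam.conj j) 2]
    simp only [← hprop p, mul_pow]
    rw [← Finset.mul_sum, ← hsq p hp, mul_comm]
  have h2 := Nat.eq_of_mul_eq_mul_left (by positivity) h1
  rw [lam.sum_conj_sq le_rfl] at h2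
  have h3 := PartitionOf.two_mul_nStat_ones n
  exact (PartitionOf.parts_eq_of_dominated lam.ones_dominated (by omega)).symm

lemma fVal_eq_iff_of_rectangular {n r : ℕ} (hn : 1 ≤ n) {μ : PartitionOf n}
    (hr : partLength μ = r) (h0 : 0 < μ.parts 0) (hμ : Rectangular μ) (lam : PartitionOf n) :
    fVal r μ lam = MVal μ ↔ ∃ lam0 : PartitionOf (μ.parts 0),
      ∀ v, 0 < v → Set.ncard {i | lam.parts i = v}
        = (n / μ.parts 0) * Set.ncard {i | lam0.parts i = v} := by
  have hall : ∀ p : Fin r, μ.parts p = μ.parts 0 := fun p =>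
    hμ p 0 (μ.parts_ne_zero_iff.mpr (hr ▸ p.2)) h0.ne'
  have hnr : n = r * μ.parts 0 := by
    have := μ.sum_fin_eq hr
    simp only [hall, Finset.sum_const, Finset.card_univ, Fintype.card_fin, smul_eq_mul] at this
    exact this.symm
  have hdiv : n / μ.parts 0 = r := Nat.div_eq_of_eq_mul_left h0 hnr
  have hr0 : 0 < r := Nat.pos_of_ne_zero fun h => by rw [h] at hnr; omega
  rw [hdiv]
  constructor
  · intro h
    obtain ⟨ρ, hu, hM⟩ := exists_isUnionOf_of_fVal_eq hn hr h0 h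
    have hprop := ((le_MVal_and_of_eq hn hr hu).2 hM).1 ⟨0, hr0⟩
    have hc : ∀ j, lam.conj j = r * (ρ ⟨0, hr0⟩).conj j := fun j => by
      have h1 : n * (ρ ⟨0, hr0⟩).conj j = μ.parts 0 * lam.conj j := hprop j
      refine Nat.eq_of_mul_eq_mul_left h0 ?_
      rw [← h1, ← mul_assoc, mul_comm (μ.parts 0) r, ← hnr]
    refine ⟨ρ ⟨0, hr0⟩, fun v hv => ?_⟩
    obtain ⟨j, rfl⟩ : ∃ j, v = j + 1 := ⟨v - 1, by omega⟩
    have h1 := lam.conj_eq_ncard_add_conj j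
    have h2 := (ρ ⟨0, hr0⟩).conj_eq_ncard_add_conj j
    rw [hc, hc, h2, mul_add] at h1
    exact (Nat.add_right_cancel h1).symm
  · rintro ⟨lam0, hl⟩
    refine le_antisymm (fVal_le_MVal hn hr _) ?_
    let ρ : ∀ p : Fin r, PartitionOf (μ.parts p) := fun p =>
      ⟨lam0.parts, lam0.antitone, lam0.eventually_zero, lam0.sum_eq.trans (hall p).symm⟩
    have hu : IsUnionOf ρ lam := fun v hv => by simp [ρ, hl v hv]
    have h1 : vStat r μ lam ≤ r * nStat lam0 := by
      simpa [ρ, nStat] using vStat_le_of_isUnionOf hu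
    have hc : ∀ j, lam.conj j = r * lam0.conj j := fun j => by
      rw [PartitionOf.conj_eq_sum_of_isUnionOf hu (fun p => μ.parts_le p) j]
      simp [ρ, PartitionOf.conj]
    have h2 := lam.sum_conj_sq le_rfl
    simp only [hc, mul_pow] at h2
    rw [← Finset.mul_sum, lam0.sum_conj_sq (μ.parts_le 0)] at h2
    have hsq : ∑ᶠ i, μ.parts i ^ 2 = r * μ.parts 0 ^ 2 := by
      rw [μ.finsum_eq_sum_fin hr fun i h => by simp [h]]
      simp [hall]
    have h1' : (n : ℚ) * vStat r μ lam ≤ n * (r * nStat lam0) := by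
      gcongr
      exact_mod_cast h1
    have h2' : (r : ℚ) ^ 2 * (2 * nStat lam0 + μ.parts 0) = 2 * nStat lam + n := by
      exact_mod_cast h2
    have hnr' : (n : ℚ) = r * μ.parts 0 := by exact_mod_cast hnr
    have h3 : (nStat lam : ℚ) = ((r : ℚ) ^ 2 * (2 * nStat lam0 + μ.parts 0) - n) / 2 := by
      linarith
    rw [MVal, hsq, fVal, h3]
    refine le_trans (le_of_eq ?_) (sub_le_sub_left h1' _)
    rw [hnr']
    push_cast
    ring

/-- Proposition: `μ₁·n(λ) − n·v(λ,μ) ≤ μ₁·n(n−1)/2 − n·(‖μ‖²−n)/2` for all `λ ∈ 𝒫ₙ`,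
with the maximum attained at `(1ⁿ)`; it is attained only there unless `μ` is
rectangular, `μ = (t^{n/t})`, in which case it is attained exactly at the unions of
`n/t` copies of a single partition `λ₀` of `t`. -/
theorem stmt_8 (n r : ℕ) (hn : 1 ≤ n) (μ : PartitionOf n) (hr : partLength μ = r) :
    (∀ lam : PartitionOf n, fVal r μ lam ≤ MVal μ) ∧
    fVal r μ (onesPartition n) = MVal μ ∧
    (¬ Rectangular μ →
      ∀ lam : PartitionOf n, fVal r μ lam = MVal μ →
        lam.parts = (onesPartition n).parts) ∧
    (Rectangular μ →
      ∀ lam : PartitionOf n, (fVal r μ lam = MVal μ ↔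
        ∃ lam0 : PartitionOf (μ.parts 0),
          ∀ v, 0 < v → Set.ncard {i | lam.parts i = v}
            = (n / μ.parts 0) * Set.ncard {i | lam0.parts i = v})) := by
  have h0 := μ.parts_zero_pos hn
  exact ⟨fVal_le_MVal hn hr, fVal_ones hn hr, fun hμ _ h => eq_ones_of_fVal_eq hn hr h0 hμ h,
    fun hμ => fVal_eq_iff_of_rectangular hn hr h0 hμ⟩
end

section
/- In the ring of formal power series in T with coefficients in the polynomial ring ℤ[z,w], the following identity holds: ∏_{n≥1} (1 − zwTⁿ)(1 − Tⁿ) = ( ∏_{n≥1} (1 − zTⁿ)(1 − wTⁿ) ) · ( 1 − (1−z)(1−w) · ( ∏_{n≥1} (1 − Tⁿ) ) · Σ_{λ ∈ 𝒫, λ ≠ ∅} φ_λ(z,w) T^{|λ|} ), where the infinite products are taken in the T-adic (coefficientwise) topology. -/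
/-- The ring `ℤ[z,w]`, with `z = X 0` and `w = X 1`. -/
abbrev Rzw : Type := MvPolynomial (Fin 2) ℤ

/-- `φ_λ(z,w) = Σ_{(i,j) ∈ λ} z^{j−1} w^{i−1}`, the sum over the cells of the Young
diagram of `λ` (rows sorted decreasingly); `φ_∅ = 0`. -/
noncomputable def phiPoly {N : ℕ} (lam : Nat.Partition N) : Rzw :=
  ∑ i ∈ Finset.range ((lam.parts.sort (· ≤ ·)).reverse).length,
    ∑ j ∈ Finset.range (((lam.parts.sort (· ≤ ·)).reverse).getD i 0),
      MvPolynomial.X 0 ^ j * MvPolynomial.X 1 ^ i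

/-- The series `Σ_{λ ∈ 𝒫, λ ≠ ∅} φ_λ(z,w) T^{|λ|} ∈ ℤ[z,w][[T]]`. -/
noncomputable def phiSeries : PowerSeries Rzw :=
  PowerSeries.mk fun N => if N = 0 then 0 else ∑ lam : Nat.Partition N, phiPoly lam

theorem List.lt_getD_iff_lt_countP {l : List ℕ} (hl : l.Pairwise (· ≥ ·)) (i j : ℕ) :
    j < l.getD i 0 ↔ i < l.countP (j < ·) := by
  induction l generalizing i with
  | nil => simp
  | cons a l ih =>
    rw [List.pairwise_cons] at hl
    have hzero : ¬ j < a → l.countP (j < ·) = 0 := fun h => by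
      rw [List.countP_eq_zero]
      intro b hb
      have := hl.1 b hb
      simp only [decide_eq_true_eq]
      omega
    rw [List.countP_cons]
    cases i with
    | zero => by_cases h : j < a <;> simp [h, hzero]
    | succ i =>
      rw [List.getD_cons_succ, ih hl.2]
      by_cases h : j < a <;> simp [h, hzero]

namespace Nat.Partition

/-- The `i`-th largest part of a partition (indexed from `0`), or `0` if there are at most `i`
parts. -/
def row {N : ℕ} (p : N.Partition) (i : ℕ) : ℕ :=
  ((p.parts.sort (· ≤ ·)).reverse).getD i 0

theorem lt_row_iff {N : ℕ} (p : N.Partition) (i j : ℕ) :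
    j < p.row i ↔ i < p.parts.countP (j < ·) := by
  rw [row, List.lt_getD_iff_lt_countP]
  · rw [List.countP_reverse, ← Multiset.coe_countP, Multiset.sort_eq]
  · rw [List.pairwise_reverse]
    exact Multiset.pairwise_sort _ _

theorem row_le {N : ℕ} (p : N.Partition) (i : ℕ) : p.row i ≤ N := by
  by_contra! h
  rw [lt_row_iff, Multiset.countP_eq_zero.2] at h
  · omega
  · exact fun a ha => (p.le_of_mem_parts ha).not_gt

theorem card_parts_le {N : ℕ} (p : N.Partition) : p.parts.card ≤ N := by
  have := Multiset.card_nsmul_le_sum (s := p.parts) (a := 1) fun x hx => p.parts_pos hx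
  simpa [p.parts_sum] using this

theorem sum_countP_lt {N : ℕ} {s : Multiset ℕ} (hs : ∀ a ∈ s, a ≤ N) :
    ((Multiset.range N).map fun j => s.countP (j < ·)).sum = s.sum := by
  induction s using Multiset.induction_on with
  | empty => simp
  | cons a s ih =>
    simp only [Multiset.countP_cons, Multiset.sum_map_add, Multiset.sum_cons]
    rw [ih fun b hb => hs b (Multiset.mem_cons_of_mem hb), add_comm]
    congr 1
    change ∑ j ∈ Finset.range N, (if j < a then 1 else 0) = a
    rw [← Finset.card_filter]
    have : (Finset.range N).filter (· < a) = Finset.range a := by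
      ext j
      have := hs a (Multiset.mem_cons_self a s)
      simp only [Finset.mem_filter, Finset.mem_range]
      omega
    rw [this, Finset.card_range]

/-- The conjugate partition. -/
def conj {N : ℕ} (p : N.Partition) : N.Partition :=
  ofSums N ((Multiset.range N).map fun j => p.parts.countP (j < ·)) <| by
    rw [sum_countP_lt fun a ha => p.le_of_mem_parts ha, p.parts_sum]

theorem countP_lt_conj {N : ℕ} (p : N.Partition) (i : ℕ) :
    p.conj.parts.countP (i < ·) = p.row i := by
  rw [conj, ofSums, Multiset.countP_filter, Multiset.countP_map]
  change ((Finset.range N).filter _).card = _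
  rw [← Finset.card_range (p.row i)]
  congr 1
  ext j
  have h1 := p.lt_row_iff i j
  have h2 := p.row_le i
  simp only [Finset.mem_filter, Finset.mem_range, ← h1]
  omega

theorem conj_injective (N : ℕ) : Function.Injective (conj : N.Partition → N.Partition) := by
  intro p q h
  have hrow (i : ℕ) : p.row i = q.row i := by
    rw [← countP_lt_conj, h, countP_lt_conj]
  have hcount (j : ℕ) : p.parts.countP (j < ·) = q.parts.countP (j < ·) := by
    refine eq_of_forall_lt_iff fun i => ?_
    rw [← lt_row_iff, ← lt_row_iff, hrow]
  have hsplit (s : Multiset ℕ) (j : ℕ) :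
      s.countP (j < ·) = s.count (j + 1) + s.countP (j + 1 < ·) := by
    induction s using Multiset.induction_on with
    | empty => simp
    | cons a s ih =>
      simp only [Multiset.countP_cons, Multiset.count_cons]
      split_ifs <;> omega
  ext a
  cases a with
  | zero =>
    rw [Multiset.count_eq_zero_of_notMem fun h => (p.parts_pos h).false,
      Multiset.count_eq_zero_of_notMem fun h => (q.parts_pos h).false]
  | succ a =>
    have h1 := hsplit p.parts a
    have h2 := hsplit q.parts a
    rw [hcount a, hcount (a + 1)] at h1
    omega

theorem sum_row_eq_sum_countP {R : Type*} [AddCommMonoid R] (N i : ℕ) (g : ℕ → R) :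
    ∑ p : N.Partition, g (p.row i) = ∑ p : N.Partition, g (p.parts.countP (i < ·)) := by
  have hb : Function.Bijective (conj : N.Partition → N.Partition) :=
    Finite.injective_iff_bijective.1 (conj_injective N)
  rw [← hb.sum_comp fun p => g (p.parts.countP (i < ·))]
  simp only [countP_lt_conj]

end Nat.Partition

section QBinomial

variable {Q : Type*} [CommRing Q]

theorem qBinomial_telescope {z T v : Q} {M : ℕ} {B D : ℕ → Q}
    (hB : ∀ i < M, B i = D i * (1 - T ^ (i + 1)))
    (hB' : ∀ i < M, B (i + 1) = D i * (1 - z * T ^ (i + 1))) {k : ℕ} (hk : k ≤ M) :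
    (1 - v) * (B 0 + (1 - z) * ∑ i ∈ Finset.range k, v ^ (i + 1) * D i) =
      (1 - z * v) * (B 0 + (1 - z) * ∑ i ∈ Finset.range k, (v * T) ^ (i + 1) * D i) -
        (1 - z) * v ^ (k + 1) * B k := by
  induction k with
  | zero => simp; ring
  | succ k ih =>
    have h := ih (by omega)
    rw [Finset.sum_range_succ, Finset.sum_range_succ]
    rw [hB k hk] at h
    rw [hB' k hk]
    linear_combination h

theorem qBinomial_of_pow_eq_zero {z w T : Q} {M : ℕ} (hT : T ^ (M + 1) = 0) {B D : ℕ → Q}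
    (hB : ∀ i < M, B i = D i * (1 - T ^ (i + 1)))
    (hB' : ∀ i < M, B (i + 1) = D i * (1 - z * T ^ (i + 1))) :
    (∏ n ∈ Finset.range M, (1 - w * T ^ (n + 1))) *
        (B M - (1 - w) * ∑ i ∈ Finset.range M, w ^ i * (B M - B i)) =
      (∏ n ∈ Finset.range M, (1 - z * w * T ^ (n + 1))) * B 0 := by
  have habel (k : ℕ) (hk : k ≤ M) : B k - (1 - w) * ∑ i ∈ Finset.range k, w ^ i * (B k - B i) =
      B 0 + (1 - z) * ∑ i ∈ Finset.range k, (w * T) ^ (i + 1) * D i := by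
    have hgeom (k : ℕ) : (1 - w) * ∑ i ∈ Finset.range k, w ^ i = 1 - w ^ k := by
      linear_combination mul_neg_geom_sum w k
    simp only [mul_sub, Finset.sum_sub_distrib, ← Finset.sum_mul] at *
    induction k with
    | zero => simp
    | succ k ih =>
      have h := ih (by omega)
      have e1 := hB k hk
      have e2 := hB' k hk
      have e3 := hgeom k
      have e4 := hgeom (k + 1)
      rw [Finset.sum_range_succ (fun i => w ^ i * B i),
        Finset.sum_range_succ (fun i => (w * T) ^ (i + 1) * D i)]
      linear_combination h - B (k + 1) * e4 + B k * e3 + w ^ (k + 1) * (e2 - e1)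
  rw [habel M le_rfl]
  have hiter (k : ℕ) : (∏ n ∈ Finset.range k, (1 - w * T ^ (n + 1))) *
        (B 0 + (1 - z) * ∑ i ∈ Finset.range M, (w * T) ^ (i + 1) * D i) =
      (∏ n ∈ Finset.range k, (1 - z * w * T ^ (n + 1))) *
        (B 0 + (1 - z) * ∑ i ∈ Finset.range M, (w * T ^ (k + 1)) ^ (i + 1) * D i) := by
    induction k with
    | zero => simp
    | succ k ih =>
      have h := qBinomial_telescope (v := w * T ^ (k + 1)) hB hB' le_rfl
      have hv : (w * T ^ (k + 1)) ^ (M + 1) = 0 := by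
        rw [mul_pow, ← pow_mul, mul_comm (k + 1), pow_mul, hT]
        simp
      rw [hv, mul_assoc w, ← pow_succ] at h
      rw [Finset.prod_range_succ, Finset.prod_range_succ]
      linear_combination (1 - w * T ^ (k + 1)) * ih +
        (∏ n ∈ Finset.range k, (1 - z * w * T ^ (n + 1))) * h
  rw [hiter M, hT]
  simp

theorem qBinomial_of_mul_prod_eq_one {z w T F : Q} {m : ℕ} (hT : T ^ (m + 1) = 0) {G : ℕ → Q}
    (hG : ∀ i ≤ m, G i * ((∏ n ∈ Finset.range i, (1 - T ^ (n + 1))) *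
      ∏ n ∈ Finset.Ico i m, (1 - z * T ^ (n + 1))) = 1)
    (hF : (1 - z) * F = ∑ i ∈ Finset.range m, w ^ i * (G m - G i)) :
    (∏ n ∈ Finset.range m, (1 - z * w * T ^ (n + 1))) * ∏ n ∈ Finset.range m, (1 - T ^ (n + 1)) =
      ((∏ n ∈ Finset.range m, (1 - z * T ^ (n + 1))) *
          ∏ n ∈ Finset.range m, (1 - w * T ^ (n + 1))) *
        (1 - (1 - z) * (1 - w) * ((∏ n ∈ Finset.range m, (1 - T ^ (n + 1))) * F)) := by
  let a (n : ℕ) := 1 - z * T ^ (n + 1)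
  let b (n : ℕ) := 1 - T ^ (n + 1)
  let B (i : ℕ) := (∏ n ∈ Finset.range i, a n) * ∏ n ∈ Finset.Ico i m, b n
  let D (i : ℕ) := (∏ n ∈ Finset.range i, a n) * ∏ n ∈ Finset.Ico (i + 1) m, b n
  have hB : ∀ i < m, B i = D i * b i := fun i hi => by
    simp only [B, D, Finset.prod_eq_prod_Ico_succ_bot hi]
    ring
  have hB' : ∀ i < m, B (i + 1) = D i * a i := fun i hi => by
    simp only [B, D, Finset.prod_range_succ]
    ring
  have hB0 : B 0 = ∏ n ∈ Finset.range m, b n := by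
    rw [Finset.range_eq_Ico]; exact one_mul _
  have hBm : B m = ∏ n ∈ Finset.range m, a n := by simp [B]
  have hBG : ∀ i ≤ m, B m * B 0 * G i = B i := fun i hi => by
    rw [hBm, hB0, ← Finset.prod_range_mul_prod_Ico a hi, ← Finset.prod_range_mul_prod_Ico b hi]
    linear_combination ((∏ n ∈ Finset.range i, a n) * ∏ n ∈ Finset.Ico i m, b n) * hG i hi
  have hsum : B m * B 0 * ((1 - z) * F) = ∑ i ∈ Finset.range m, w ^ i * (B m - B i) := by
    rw [hF, Finset.mul_sum]
    refine Finset.sum_congr rfl fun i hi => ?_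
    linear_combination w ^ i * (hBG m le_rfl - hBG i (Finset.mem_range.1 hi).le)
  have hq := qBinomial_of_pow_eq_zero (w := w) hT hB hB'
  rw [← hsum, hB0, hBm] at hq
  linear_combination -hq

end QBinomial

namespace Nat.Partition

open PowerSeries in
open scoped PowerSeries.WithPiTopology in
/-- Modulo `X ^ (M + 1)`, the generating function of partitions weighted multiplicatively by
`a` is inverse to `∏ (1 - a n * X ^ n)`. -/
theorem X_pow_dvd_genFun_mul_prod_sub_one {R : Type*} [CommRing R] (a : ℕ → R) (M : ℕ) :
    (X : R⟦X⟧) ^ (M + 1) ∣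
      genFun (fun n c => a n ^ c) *
        ∏ n ∈ Finset.range M, (1 - C (a (n + 1)) * X ^ (n + 1)) - 1 := by
  let : TopologicalSpace R := ⊥
  have : DiscreteTopology R := ⟨rfl⟩
  have hfactor (i : ℕ) :
      (1 + ∑' j, a (i + 1) ^ (j + 1) • (X : R⟦X⟧) ^ ((i + 1) * (j + 1))) *
        (1 - C (a (i + 1)) * X ^ (i + 1)) = 1 := by
    have hsum := (summable_genFun_term (fun n c => a n ^ c) i).hasSum
    set y : R⟦X⟧ := C (a (i + 1)) * X ^ (i + 1) with hy
    have hterm (j : ℕ) : a (i + 1) ^ (j + 1) • (X : R⟦X⟧) ^ ((i + 1) * (j + 1)) = y ^ (j + 1) := by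
      rw [hy, mul_pow, smul_eq_C_mul, map_pow, pow_mul]
    simp only [hterm] at hsum ⊢
    have h1 : y * ∑' j, y ^ (j + 1) + y = ∑' j, y ^ (j + 1) := by
      rw [← hsum.summable.tsum_mul_left, hsum.summable.tsum_eq_zero_add, zero_add, pow_one,
        add_comm]
      simp only [← _root_.pow_succ']
    linear_combination -h1
  obtain ⟨s, hsM, hs⟩ : ∃ s : Finset ℕ, Finset.range M ⊆ s ∧ ∀ d < M + 1,
      coeff d (∏ i ∈ s, (1 + ∑' j, a (i + 1) ^ (j + 1) • (X : R⟦X⟧) ^ ((i + 1) * (j + 1)))) =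
        coeff d (genFun fun n c => a n ^ c) := by
    have h := hasProd_genFun (fun n c => a n ^ c)
    rw [HasProd, WithPiTopology.tendsto_iff_coeff_tendsto] at h
    simp only [nhds_discrete, Filter.tendsto_pure] at h
    have h' := (Filter.eventually_all_finset (Finset.range (M + 1))).2 fun d _ => h d
    obtain ⟨s, h1, h2⟩ := ((Filter.eventually_ge_atTop (Finset.range M)).and h').exists
    exact ⟨s, h1, fun d hd => h2 d (Finset.mem_range.2 hd)⟩
  have hdvd : (X : R⟦X⟧) ^ (M + 1) ∣ (genFun fun n c => a n ^ c) -
      ∏ i ∈ s, (1 + ∑' j, a (i + 1) ^ (j + 1) • (X : R⟦X⟧) ^ ((i + 1) * (j + 1))) := by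
    rw [X_pow_dvd_iff]
    intro d hd
    rw [map_sub, hs d hd, sub_self]
  have htail : (X : R⟦X⟧) ^ (M + 1) ∣
      ∏ n ∈ s \ Finset.range M, (1 - C (a (n + 1)) * X ^ (n + 1)) - 1 := by
    refine Finset.prod_induction _ (fun y => (X : R⟦X⟧) ^ (M + 1) ∣ y - 1) (fun x y hx hy => ?_)
      (by simp) fun n hn => ?_
    · have hxy : x * y - 1 = x * (y - 1) + (x - 1) := by ring
      rw [hxy]
      exact dvd_add (Dvd.dvd.mul_left hy x) hx
    · rw [sub_sub_cancel_left, dvd_neg]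
      refine Dvd.dvd.mul_left (pow_dvd_pow _ ?_) _
      simp only [Finset.mem_sdiff, Finset.mem_range] at hn
      omega
  have hsplit := Finset.prod_sdiff (f := fun n => (1 - C (a (n + 1)) * (X : R⟦X⟧) ^ (n + 1))) hsM
  have hone : (∏ i ∈ s, (1 + ∑' j, a (i + 1) ^ (j + 1) • (X : R⟦X⟧) ^ ((i + 1) * (j + 1)))) *
      ∏ n ∈ s, (1 - C (a (n + 1)) * X ^ (n + 1)) = 1 := by
    rw [← Finset.prod_mul_distrib]
    exact Finset.prod_eq_one fun i _ => hfactor i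
  rw [← hsplit] at hone
  obtain ⟨u, hu⟩ := hdvd
  obtain ⟨t, ht⟩ := htail
  set F := genFun fun n c => a n ^ c
  set p := ∏ n ∈ Finset.range M, (1 - C (a (n + 1)) * (X : R⟦X⟧) ^ (n + 1))
  set q := ∏ n ∈ s \ Finset.range M, (1 - C (a (n + 1)) * (X : R⟦X⟧) ^ (n + 1))
  refine ⟨u * (q * p) - F * p * t, ?_⟩
  linear_combination (q * p) * hu - F * p * ht + hone

theorem prod_toFinsupp_ite {R : Type*} [CommMonoid R] {N : ℕ} (p : N.Partition) (i : ℕ) (z : R) :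
    (p.parts.toFinsupp.prod fun n c => (if i < n then z else 1) ^ c) =
      z ^ p.parts.countP (i < ·) := by
  trans (p.parts.map fun n => if i < n then z else 1).prod
  · rw [Finset.prod_multiset_map_count]
    rfl
  · induction p.parts using Multiset.induction_on with
    | empty => simp
    | cons a s ih =>
      rw [Multiset.map_cons, Multiset.prod_cons, ih, Multiset.countP_cons]
      split_ifs <;> simp [_root_.pow_succ']

theorem coeff_genFun_ite {R : Type*} [CommSemiring R] (N i : ℕ) (z : R) :
    (genFun fun n c => (if i < n then z else 1) ^ c).coeff N = ∑ p : N.Partition, z ^ p.row i := by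
  rw [coeff_genFun, sum_row_eq_sum_countP N i (z ^ ·)]
  simp only [prod_toFinsupp_ite]

end Nat.Partition

namespace Nat.Partition

theorem length_sort_reverse {N : ℕ} (p : N.Partition) :
    ((p.parts.sort (· ≤ ·)).reverse).length = p.parts.card := by
  rw [List.length_reverse, Multiset.length_sort]

theorem row_eq_zero {N : ℕ} (p : N.Partition) {i : ℕ} (hi : p.parts.card ≤ i) : p.row i = 0 :=
  List.getD_eq_default _ _ (by rwa [length_sort_reverse])

theorem one_sub_mul_phiPoly {N M : ℕ} (p : N.Partition) (hM : N ≤ M) :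
    (1 - MvPolynomial.X 0) * phiPoly p =
      ∑ i ∈ Finset.range M, (MvPolynomial.X 1 : Rzw) ^ i * (1 - MvPolynomial.X 0 ^ p.row i) := by
  have hsub : Finset.range p.parts.card ⊆ Finset.range M :=
    Finset.range_subset_range.2 (p.card_parts_le.trans hM)
  rw [← Finset.sum_subset hsub fun i _ hi => by
    rw [p.row_eq_zero (by simpa using hi), pow_zero, sub_self, mul_zero]]
  rw [phiPoly, length_sort_reverse, Finset.mul_sum]
  refine Finset.sum_congr rfl fun i _ => ?_
  rw [← Finset.sum_mul, ← mul_assoc]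
  have := mul_neg_geom_sum (MvPolynomial.X 0 : Rzw) (p.row i)
  rw [row] at this ⊢
  rw [this, mul_comm]

end Nat.Partition

open PowerSeries Nat.Partition in
/-- Row-by-row evaluation of `(1 - z) Σ φ_λ T^{|λ|}` modulo `T ^ (M + 1)`. -/
theorem X_pow_dvd_one_sub_mul_phiSeries_sub (M : ℕ) :
    (X : Rzw⟦X⟧) ^ (M + 1) ∣ C (1 - MvPolynomial.X 0) * phiSeries -
      ∑ i ∈ Finset.range M, C (MvPolynomial.X 1) ^ i *
        ((genFun fun n c => (if M < n then (MvPolynomial.X 0 : Rzw) else 1) ^ c) -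
          genFun fun n c => (if i < n then (MvPolynomial.X 0 : Rzw) else 1) ^ c) := by
  rw [X_pow_dvd_iff]
  intro N hN
  have hphi : coeff N phiSeries = ∑ p : N.Partition, phiPoly p := by
    rw [phiSeries, coeff_mk]
    split_ifs with h
    · subst h
      refine (Finset.sum_eq_zero fun p _ => ?_).symm
      rw [phiPoly, length_sort_reverse]
      have := p.card_parts_le
      rw [Nat.le_zero.1 this, Finset.range_zero, Finset.sum_empty]
    · rfl
  rw [map_sub, sub_eq_zero, coeff_C_mul, hphi, map_sum, Finset.mul_sum]
  simp only [← map_pow, coeff_C_mul, map_sub, coeff_genFun_ite]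
  rw [Finset.sum_congr rfl fun p _ => p.one_sub_mul_phiPoly (Nat.lt_succ_iff.1 hN),
    Finset.sum_comm]
  refine Finset.sum_congr rfl fun i _ => ?_
  rw [← Finset.sum_sub_distrib, Finset.mul_sum]
  refine Finset.sum_congr rfl fun p _ => ?_
  rw [p.row_eq_zero (p.card_parts_le.trans (Nat.lt_succ_iff.1 hN)), pow_zero]

/-- The identity
`∏_{n≥1}(1−zwTⁿ)(1−Tⁿ) = (∏_{n≥1}(1−zTⁿ)(1−wTⁿ))·(1 − (1−z)(1−w)(∏_{n≥1}(1−Tⁿ))·Σ_{λ≠∅} φ_λ T^{|λ|})`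
in `ℤ[z,w][[T]]`, with infinite products taken in the T-adic (coefficientwise)
topology: each `T`-coefficient of the two sides agrees once the partial products
include all factors of index up to that degree. -/
theorem stmt_12 :
    ∀ d m : ℕ, d ≤ m →
      PowerSeries.coeff (R := Rzw) d
        (∏ n ∈ Finset.range m,
          ((1 - PowerSeries.C (R := Rzw) (MvPolynomial.X 0 * MvPolynomial.X 1) *
              PowerSeries.X ^ (n + 1)) *
           (1 - (PowerSeries.X : PowerSeries Rzw) ^ (n + 1)))) =
      PowerSeries.coeff (R := Rzw) d
        ((∏ n ∈ Finset.range m,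
            ((1 - PowerSeries.C (R := Rzw) (MvPolynomial.X 0) * PowerSeries.X ^ (n + 1)) *
             (1 - PowerSeries.C (R := Rzw) (MvPolynomial.X 1) * PowerSeries.X ^ (n + 1)))) *
         (1 - PowerSeries.C (R := Rzw) ((1 - MvPolynomial.X 0) * (1 - MvPolynomial.X 1)) *
            ((∏ n ∈ Finset.range m,
                (1 - (PowerSeries.X : PowerSeries Rzw) ^ (n + 1))) * phiSeries))) := by
  intro d m hdm
  have hmk {a b : PowerSeries Rzw} :
      Ideal.Quotient.mk (Ideal.span {PowerSeries.X ^ (m + 1)}) a =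
        Ideal.Quotient.mk (Ideal.span {PowerSeries.X ^ (m + 1)}) b ↔
      PowerSeries.X ^ (m + 1) ∣ a - b := by
    rw [Ideal.Quotient.mk_eq_mk_iff_sub_mem, Ideal.mem_span_singleton]
  generalize Ideal.Quotient.mk (Ideal.span {(PowerSeries.X : PowerSeries Rzw) ^ (m + 1)}) = π
    at hmk
  have hcoeff {a b : PowerSeries Rzw} (h : π a = π b) :
      PowerSeries.coeff d a = PowerSeries.coeff d b := by
    have := PowerSeries.X_pow_dvd_iff.1 (hmk.1 h) d (by omega)
    rwa [map_sub, sub_eq_zero] at this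
  apply hcoeff
  have hT : π PowerSeries.X ^ (m + 1) = 0 := by
    rw [← map_pow, ← map_zero π, hmk, sub_zero]
  have hG (i : ℕ) (hi : i ≤ m) := hmk.2 (Nat.Partition.X_pow_dvd_genFun_mul_prod_sub_one
    (fun n => if i < n then (MvPolynomial.X 0 : Rzw) else 1) m)
  have hF := hmk.2 (X_pow_dvd_one_sub_mul_phiSeries_sub m)
  simp only [map_mul, map_sub, map_one, map_sum, map_pow] at hF
  simp only [map_mul, map_sub, map_one, map_prod, map_pow, Finset.prod_mul_distrib]
  refine qBinomial_of_mul_prod_eq_one hT (fun i hi => ?_) hF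
  have h := hG i hi
  rw [map_mul, map_prod, map_one, ← Finset.prod_range_mul_prod_Ico _ hi] at h
  refine Eq.trans ?_ h
  congr 2
  · refine Finset.prod_congr rfl fun n hn => ?_
    rw [if_neg (by have := Finset.mem_range.1 hn; omega)]
    simp only [map_sub, map_one, map_pow, one_mul]
  · refine Finset.prod_congr rfl fun n hn => ?_
    rw [if_pos (by have := Finset.mem_Ico.1 hn; omega)]
    simp only [map_sub, map_mul, map_one, map_pow]
end

section
/- Let K = ℚ(w) be the field of rational functions in w over ℚ, and in K[[q]] define θ := (1 − w) · ∏_{n≥1} (1 − qⁿw)(1 − qⁿw⁻¹)(1 − qⁿ)⁻², the product converging in the q-adic topology. Then θ · ( (1 − w)⁻¹ + Σ_{n,m ≥ 1, n + m odd} (−1)ⁿ q^{nm/2} w^{(m−n−1)/2} ) = 1 in K[[q]]. -/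
open PowerSeries

/-- The partial products of the theta function
`θ = (1−w)·∏_{n≥1} (1−qⁿw)(1−qⁿw⁻¹)(1−qⁿ)⁻²` in `K[[q]]`, `K = ℚ(w)`. -/
noncomputable def thetaPartial (m : ℕ) : PowerSeries (RatFunc ℚ) :=
  (1 - PowerSeries.C (R := RatFunc ℚ) RatFunc.X) *
    ∏ n ∈ Finset.range m,
      ((1 - PowerSeries.C (R := RatFunc ℚ) RatFunc.X * PowerSeries.X ^ (n + 1)) *
       (1 - PowerSeries.C (R := RatFunc ℚ) (RatFunc.X)⁻¹ * PowerSeries.X ^ (n + 1)) *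
       ((1 - (PowerSeries.X : PowerSeries (RatFunc ℚ)) ^ (n + 1))⁻¹) ^ 2)

/-- The Kronecker-type expansion
`(1−w)⁻¹ + Σ_{n,m≥1, n+m odd} (−1)ⁿ q^{nm/2} w^{(m−n−1)/2} ∈ K[[q]]`. -/
noncomputable def krSum : PowerSeries (RatFunc ℚ) :=
  PowerSeries.C (R := RatFunc ℚ) ((1 - RatFunc.X)⁻¹) +
    PowerSeries.mk fun N =>
      ∑ p ∈ (Finset.range (2 * N + 1) ×ˢ Finset.range (2 * N + 1)).filter
          (fun p => 1 ≤ p.1 ∧ 1 ≤ p.2 ∧ ¬ Even (p.1 + p.2) ∧ p.1 * p.2 = 2 * N),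
        (-1 : RatFunc ℚ) ^ p.1 * RatFunc.X ^ (((p.2 : ℤ) - (p.1 : ℤ) - 1) / 2)

/-- The triangular number `n(n+1)/2`. -/
def triangular : ℕ → ℕ
  | 0 => 0
  | n + 1 => triangular n + (n + 1)

theorem two_mul_triangular (n : ℕ) : 2 * triangular n = n * (n + 1) := by
  induction n with
  | zero => rfl
  | succ n ih => rw [triangular, mul_add, ih]; ring

theorem le_triangular (n : ℕ) : n ≤ triangular n := by
  cases n with
  | zero => simp
  | succ n => rw [triangular]; omega

section FinitePartialFractions

variable {R : Type*} [CommRing R] {q w v : R} {r a b e : ℕ → R}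

/-- A telescoping finite `q`-binomial sum, where `r n` plays the role of `1 / (q; q)ₙ`. -/
theorem qBinomial_partial_sum (hr : ∀ n, r (n + 1) * (1 - q ^ (n + 1)) = r n) (n j : ℕ) :
    (1 - q ^ (n + j + 1)) * (r (n + j + 1) ^ 2 + ∑ i ∈ Finset.range n,
      (-1) ^ (i + 1) * q ^ triangular i * (1 + q ^ (i + 1)) *
        (r (n + j - i) * r (n + j + 1 + (i + 1)))) =
      (-1) ^ n * q ^ triangular n * (r j * r (n + j + 1 + n)) := by
  induction n generalizing j with
  | zero =>
    have h := hr j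
    simp only [triangular, Finset.range_zero, Finset.sum_empty, zero_add, add_zero, pow_zero]
    linear_combination r (j + 1) * h
  | succ n ih =>
    have ih' := ih (j + 1)
    have e1 : n + 1 + j = n + (j + 1) := by ring
    rw [Finset.sum_range_succ, e1, show n + (j + 1) - n = j + 1 by omega, triangular]
    have h1 := hr j
    have h2 := hr (n + (j + 1) + 1 + n)
    rw [show n + (j + 1) + 1 + (n + 1) = n + (j + 1) + 1 + n + 1 by ring]
    rw [← h1]
    rw [← h2] at ih'
    linear_combination ih'

theorem qBinomial_sum_eq_zero (hr : ∀ n, r (n + 1) * (1 - q ^ (n + 1)) = r n)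
    (he : ∀ n, e n * (1 - q ^ (n + 1)) = 1) (n : ℕ) :
    r (n + 1) ^ 2 + ∑ i ∈ Finset.range (n + 1),
      (-1) ^ (i + 1) * q ^ triangular i * (1 + q ^ (i + 1)) *
        (r (n - i) * r (n + 1 + (i + 1))) = 0 := by
  have h := qBinomial_partial_sum hr n 0
  have h2 := hr (n + 1 + n)
  rw [Finset.sum_range_succ, Nat.sub_self, show n + 1 + (n + 1) = n + 1 + n + 1 by ring]
  simp only [add_zero] at h
  rw [← h2] at h
  have hn := he n
  set S := ∑ i ∈ Finset.range n, (-1) ^ (i + 1) * q ^ triangular i * (1 + q ^ (i + 1)) *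
        (r (n - i) * r (n + 1 + (i + 1)))
  linear_combination e n * h - (r (n + 1) ^ 2 + S + (-1) ^ (n + 1) * q ^ triangular n *
    (1 + q ^ (n + 1)) * (r 0 * r (n + 1 + n + 1))) * hn

/-- The partial fraction expansion of the reciprocal of `∏ (1 - w qⁿ)(1 - w⁻¹ qⁿ)`, with the poles
at `w = qᵏ` and `w = q⁻ᵏ` paired up. -/
theorem finite_partial_fractions (hr0 : r 0 = 1)
    (hr : ∀ n, r (n + 1) * (1 - q ^ (n + 1)) = r n)
    (he : ∀ n, e n * (1 - q ^ (n + 1)) = 1) (hwv : w * v = 1)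
    (ha : ∀ n, a n * (1 - w * q ^ (n + 1)) = 1) (hb : ∀ n, b n * (1 - v * q ^ (n + 1)) = 1)
    (N : ℕ) :
    (∏ n ∈ Finset.range N, (1 - w * q ^ (n + 1)) * (1 - v * q ^ (n + 1))) *
      (r N ^ 2 + ∑ i ∈ Finset.range N,
        (-1) ^ (i + 1) * q ^ triangular (i + 1) * (1 + q ^ (i + 1)) * ((1 - w) * (1 - v)) *
          (r (N - (i + 1)) * r (N + (i + 1))) * (a i * b i)) = 1 := by
  induction N with
  | zero => simp [hr0]
  | succ N ih =>
    rw [Finset.prod_range_succ]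
    have hterm : ∀ i ∈ Finset.range N,
        (1 - w * q ^ (N + 1)) * (1 - v * q ^ (N + 1)) *
        ((-1) ^ (i + 1) * q ^ triangular (i + 1) * (1 + q ^ (i + 1)) * ((1 - w) * (1 - v)) *
          (r (N + 1 - (i + 1)) * r (N + 1 + (i + 1))) * (a i * b i)) =
        (-1) ^ (i + 1) * q ^ triangular (i + 1) * (1 + q ^ (i + 1)) * ((1 - w) * (1 - v)) *
          (r (N - (i + 1)) * r (N + (i + 1))) * (a i * b i) +
        q ^ (N + 1) * ((1 - w) * (1 - v)) *
          ((-1) ^ (i + 1) * q ^ triangular i * (1 + q ^ (i + 1)) *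
            (r (N - i) * r (N + 1 + (i + 1)))) := by
      intro i hi
      obtain ⟨j, rfl⟩ := Nat.exists_eq_add_of_lt (Finset.mem_range.1 hi)
      rw [show i + j + 1 + 1 - (i + 1) = j + 1 by omega, show i + j + 1 - (i + 1) = j by omega,
        show i + j + 1 - i = j + 1 by omega,
        show i + j + 1 + 1 + (i + 1) = i + j + 1 + (i + 1) + 1 by ring,
        ← hr j, ← hr (i + j + 1 + (i + 1)), triangular]
      have hab : a i * b i * ((1 - w * q ^ (i + 1)) * (1 - v * q ^ (i + 1))) = 1 := by
        linear_combination (b i * (1 - v * q ^ (i + 1))) * ha i + hb i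
      have key : (1 - w * q ^ (i + j + 1 + 1)) * (1 - v * q ^ (i + j + 1 + 1)) -
          (1 - q ^ (j + 1)) * (1 - q ^ (i + j + 1 + (i + 1) + 1)) =
          q ^ (j + 1) * ((1 - w * q ^ (i + 1)) * (1 - v * q ^ (i + 1))) := by
        linear_combination (q ^ (i + j + 1 + 1) * q ^ (i + j + 1 + 1) -
          q ^ (j + 1) * q ^ (i + 1) * q ^ (i + 1)) * hwv
      set A := r (j + 1)
      set B := r (i + j + 1 + (i + 1) + 1)
      linear_combination ((-1) ^ (i + 1) * q ^ (triangular i + (i + 1)) * (1 + q ^ (i + 1)) *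
        ((1 - w) * (1 - v)) * (A * B)) * ((a i * b i) * key + q ^ (j + 1) * hab)
    have hlast : (1 - w * q ^ (N + 1)) * (1 - v * q ^ (N + 1)) *
        ((-1) ^ (N + 1) * q ^ triangular (N + 1) * (1 + q ^ (N + 1)) * ((1 - w) * (1 - v)) *
          (r (N + 1 - (N + 1)) * r (N + 1 + (N + 1))) * (a N * b N)) =
        q ^ (N + 1) * ((1 - w) * (1 - v)) *
          ((-1) ^ (N + 1) * q ^ triangular N * (1 + q ^ (N + 1)) *
            (r (N - N) * r (N + 1 + (N + 1)))) := by
      have hab : a N * b N * ((1 - w * q ^ (N + 1)) * (1 - v * q ^ (N + 1))) = 1 := by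
        linear_combination (b N * (1 - v * q ^ (N + 1))) * ha N + hb N
      rw [triangular, Nat.sub_self, Nat.sub_self, pow_add q (triangular N)]
      linear_combination ((-1) ^ (N + 1) * q ^ triangular N * q ^ (N + 1) * (1 + q ^ (N + 1)) *
        ((1 - w) * (1 - v)) * (r 0 * r (N + 1 + (N + 1)))) * hab
    have hsum : (1 - w * q ^ (N + 1)) * (1 - v * q ^ (N + 1)) *
        (r (N + 1) ^ 2 + ∑ i ∈ Finset.range (N + 1),
          (-1) ^ (i + 1) * q ^ triangular (i + 1) * (1 + q ^ (i + 1)) * ((1 - w) * (1 - v)) *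
            (r (N + 1 - (i + 1)) * r (N + 1 + (i + 1))) * (a i * b i)) =
        r N ^ 2 + ∑ i ∈ Finset.range N,
          (-1) ^ (i + 1) * q ^ triangular (i + 1) * (1 + q ^ (i + 1)) * ((1 - w) * (1 - v)) *
            (r (N - (i + 1)) * r (N + (i + 1))) * (a i * b i) := by
      have hzero := qBinomial_sum_eq_zero hr he N
      rw [Finset.sum_range_succ] at hzero
      rw [Finset.sum_range_succ, mul_add, mul_add, Finset.mul_sum, Finset.sum_congr rfl hterm,
        hlast, Finset.sum_add_distrib, ← Finset.mul_sum, ← hr N]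
      linear_combination (q ^ (N + 1) * ((1 - w) * (1 - v))) * hzero +
        r (N + 1) ^ 2 * (q ^ (N + 1) * q ^ (N + 1) - q ^ (N + 1)) * hwv
    rw [mul_assoc, hsum, ih]

end FinitePartialFractions

section PowerSeries

variable {K : Type*} [Field K]

theorem one_sub_C_mul_X_pow_inv_mul (c : K) (n : ℕ) :
    (1 - C c * X ^ (n + 1))⁻¹ * (1 - C c * X ^ (n + 1)) = (1 : K⟦X⟧) :=
  PowerSeries.inv_mul_cancel _ (by simp)

theorem one_sub_X_pow_inv_mul (n : ℕ) :
    (1 - X ^ (n + 1))⁻¹ * (1 - X ^ (n + 1)) = (1 : K⟦X⟧) :=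
  PowerSeries.inv_mul_cancel _ (by simp)

theorem coeff_X_pow_mul_one_sub_inv (c : K) (t k d : ℕ) :
    coeff d (X ^ t * (1 - C c * X ^ (k + 1))⁻¹) =
      ∑ j ∈ Finset.range (d + 1), if t + (k + 1) * j = d then c ^ j else 0 := by
  have hgeom := mul_neg_geom_sum (C c * X ^ (k + 1)) (d + 1)
  have hinv := one_sub_C_mul_X_pow_inv_mul c k
  have hsplit : X ^ t * (1 - C c * X ^ (k + 1))⁻¹ =
      ∑ j ∈ Finset.range (d + 1), C (c ^ j) * X ^ (t + (k + 1) * j) +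
      X ^ (d + 1) * (X ^ t * (1 - C c * X ^ (k + 1))⁻¹ * C c ^ (d + 1) * X ^ (k * (d + 1))) := by
    have hs : ∑ j ∈ Finset.range (d + 1), C (c ^ j) * X ^ (t + (k + 1) * j) =
        X ^ t * ∑ j ∈ Finset.range (d + 1), (C c * X ^ (k + 1)) ^ j := by
      rw [Finset.mul_sum]
      refine Finset.sum_congr rfl fun j _ => ?_
      rw [map_pow]; ring
    rw [hs]
    generalize ∑ j ∈ Finset.range (d + 1), (C c * X ^ (k + 1)) ^ j = S at *
    generalize (1 - C c * X ^ (k + 1))⁻¹ = A at *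
    linear_combination (-X ^ t * A) * hgeom + (X ^ t * S) * hinv
  rw [hsplit, map_add, map_sum, PowerSeries.coeff_X_pow_mul', if_neg (by omega), add_zero]
  refine Finset.sum_congr rfl fun j _ => ?_
  rw [coeff_C_mul, coeff_X_pow, mul_ite, mul_one, mul_zero]
  simp only [eq_comm]

theorem X_pow_dvd_sub_of_mul_eq {r : ℕ → K⟦X⟧}
    (hr : ∀ n, r (n + 1) * (1 - X ^ (n + 1)) = r n) (n j : ℕ) :
    X ^ (n + 1) ∣ r (n + j) - r n := by
  induction j with
  | zero => simp
  | succ j ih =>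
    have h : r (n + (j + 1)) - r n = r (n + j + 1) * X ^ (n + j + 1) + (r (n + j) - r n) := by
      rw [← hr (n + j), ← add_assoc]; ring
    rw [h]
    exact dvd_add (Dvd.dvd.mul_left (pow_dvd_pow _ (by omega)) _) ih

theorem X_pow_dvd_X_pow_triangular_mul {r : ℕ → K⟦X⟧}
    (hr : ∀ n, r (n + 1) * (1 - X ^ (n + 1)) = r n) {k m : ℕ} (hk : k ≤ m) :
    X ^ (m + 1) ∣ X ^ triangular k * (r m ^ 2 - r (m - k) * r (m + k)) := by
  obtain ⟨j, rfl⟩ := Nat.exists_eq_add_of_le' hk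
  rw [Nat.add_sub_cancel]
  have h1 := X_pow_dvd_sub_of_mul_eq hr j k
  have h2 := X_pow_dvd_sub_of_mul_eq hr (j + k) k
  have h3 : X ^ (j + k + 1) ∣ X ^ triangular k * (r (j + k) - r j) := by
    refine dvd_trans ?_ (mul_dvd_mul (pow_dvd_pow X (le_triangular k)) h1)
    rw [← pow_add]
    exact pow_dvd_pow _ (by omega)
  have h : X ^ triangular k * (r (j + k) ^ 2 - r j * r (j + k + k)) =
      X ^ triangular k * (r (j + k) - r j) * r (j + k) +
        (r (j + k + k) - r (j + k)) * (-X ^ triangular k * r j) := by ring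
  rw [h]
  exact dvd_add (h3.mul_right _) (h2.mul_right _)

end PowerSeries

/-- Reindexing the pairs `(n, m)` of opposite parity with `n < m` by `n = i + 1`,
`m = i + 2 + 2 * j`. -/
theorem sum_opposite_parity_lt {M : Type*} [AddCommMonoid M] (f : ℕ → ℕ → M) {d m : ℕ}
    (hd : d ≤ m) :
    ∑ i ∈ Finset.range m, ∑ j ∈ Finset.range (d + 1),
      (if triangular (i + 1) + (i + 1) * j = d then f (i + 1) (i + 2 + 2 * j) else 0) =
    ∑ p ∈ (Finset.range (2 * d + 1) ×ˢ Finset.range (2 * d + 1)).filter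
      (fun p => (1 ≤ p.1 ∧ 1 ≤ p.2 ∧ ¬ Even (p.1 + p.2) ∧ p.1 * p.2 = 2 * d) ∧ p.1 < p.2),
      f p.1 p.2 := by
  have hiff : ∀ i j, triangular (i + 1) + (i + 1) * j = d ↔ (i + 1) * (i + 2 + 2 * j) = 2 * d := by
    intro i j
    have h := two_mul_triangular (i + 1)
    constructor <;> intro h' <;> nlinarith
  rw [← Finset.sum_product', ← Finset.sum_filter]
  refine Finset.sum_bij' (fun p _ => (p.1 + 1, p.1 + 2 + 2 * p.2))
    (fun p _ => (p.1 - 1, (p.2 - p.1 - 1) / 2)) ?_ ?_ ?_ ?_ ?_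
  · rintro ⟨i, j⟩ h
    simp only [Finset.mem_filter, Finset.mem_product, Finset.mem_range, hiff] at h ⊢
    obtain ⟨-, h⟩ := h
    refine ⟨⟨?_, ?_⟩, ⟨by omega, by omega, ?_, h⟩, by omega⟩
    · nlinarith
    · nlinarith
    · rw [Nat.even_iff]; omega
  · rintro ⟨n, k⟩ h
    simp only [Finset.mem_filter, Finset.mem_product, Finset.mem_range, hiff] at h ⊢
    obtain ⟨-, ⟨h1, h2, h3, h4⟩, h5⟩ := h
    rw [Nat.even_iff] at h3
    obtain ⟨i, rfl⟩ := Nat.exists_eq_add_of_le' h1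
    obtain ⟨j, rfl⟩ : ∃ j, k = i + 2 + 2 * j := ⟨(k - i - 2) / 2, by omega⟩
    have e : (i + 2 + 2 * j - (i + 1) - 1) / 2 = j := by omega
    rw [e, Nat.add_sub_cancel]
    refine ⟨⟨?_, ?_⟩, h4⟩ <;> nlinarith
  · rintro ⟨i, j⟩ -
    ext
    · simp
    · simp only []
      omega
  · rintro ⟨n, k⟩ h
    simp only [Finset.mem_filter, Nat.even_iff] at h
    ext <;> simp <;> omega
  · rintro ⟨i, j⟩ -
    rfl

theorem sum_opposite_parity {M : Type*} [AddCommMonoid M] (f : ℕ → ℕ → M) {d m : ℕ}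
    (hd : d ≤ m) :
    ∑ p ∈ (Finset.range (2 * d + 1) ×ˢ Finset.range (2 * d + 1)).filter
      (fun p => 1 ≤ p.1 ∧ 1 ≤ p.2 ∧ ¬ Even (p.1 + p.2) ∧ p.1 * p.2 = 2 * d), f p.1 p.2 =
    ∑ i ∈ Finset.range m, ∑ j ∈ Finset.range (d + 1),
      (if triangular (i + 1) + (i + 1) * j = d then
        f (i + 1) (i + 2 + 2 * j) + f (i + 2 + 2 * j) (i + 1) else 0) := by
  have h := sum_opposite_parity_lt (fun n k => f n k + f k n) hd
  rw [h, Finset.sum_add_distrib, ← Finset.sum_filter_add_sum_filter_not _ (fun p => p.1 < p.2),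
    Finset.filter_filter, Finset.filter_filter]
  congr 1
  refine Finset.sum_bij' (fun p _ => (p.2, p.1)) (fun p _ => (p.2, p.1)) ?_ ?_ ?_ ?_ ?_
  · rintro ⟨n, k⟩ h
    simp only [Finset.mem_filter, Finset.mem_product, Nat.even_iff] at h ⊢
    obtain ⟨h0, ⟨h1, h2, h3, h4⟩, h5⟩ := h
    exact ⟨⟨h0.2, h0.1⟩, ⟨h2, h1, by omega, by rw [mul_comm, h4]⟩, by omega⟩
  · rintro ⟨n, k⟩ h
    simp only [Finset.mem_filter, Finset.mem_product, Nat.even_iff] at h ⊢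
    obtain ⟨h0, ⟨h1, h2, h3, h4⟩, h5⟩ := h
    exact ⟨⟨h0.2, h0.1⟩, ⟨h2, h1, by omega, by rw [mul_comm, h4]⟩, by omega⟩
  all_goals simp

theorem coeff_krSum {d m : ℕ} (hd : d ≤ m) :
    coeff d krSum = coeff d (C (1 - RatFunc.X : RatFunc ℚ)⁻¹ + ∑ i ∈ Finset.range m,
      (-1) ^ (i + 1) * X ^ triangular (i + 1) *
        ((1 - C RatFunc.X * X ^ (i + 1))⁻¹ -
          C (RatFunc.X)⁻¹ * (1 - C (RatFunc.X)⁻¹ * X ^ (i + 1))⁻¹)) := by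
  rw [krSum, map_add, map_add, coeff_mk, map_sum,
    sum_opposite_parity (fun n k => (-1 : RatFunc ℚ) ^ n *
      RatFunc.X ^ (((k : ℤ) - (n : ℤ) - 1) / 2)) hd]
  congr 1
  refine Finset.sum_congr rfl fun i _ => ?_
  have hsplit : (-1) ^ (i + 1) * X ^ triangular (i + 1) *
        ((1 - C RatFunc.X * X ^ (i + 1))⁻¹ -
          C (RatFunc.X)⁻¹ * (1 - C (RatFunc.X)⁻¹ * X ^ (i + 1))⁻¹) =
      C ((-1 : RatFunc ℚ) ^ (i + 1)) *
        (X ^ triangular (i + 1) * (1 - C RatFunc.X * X ^ (i + 1))⁻¹) -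
      C ((-1 : RatFunc ℚ) ^ (i + 1) * (RatFunc.X)⁻¹) *
        (X ^ triangular (i + 1) * (1 - C (RatFunc.X)⁻¹ * X ^ (i + 1))⁻¹) := by
    simp only [map_mul, map_pow, map_neg, map_one]
    ring
  rw [hsplit, map_sub, coeff_C_mul, coeff_C_mul, coeff_X_pow_mul_one_sub_inv,
    coeff_X_pow_mul_one_sub_inv, Finset.mul_sum, Finset.mul_sum, ← Finset.sum_sub_distrib]
  refine Finset.sum_congr rfl fun j _ => ?_
  split_ifs
  · have e1 : (((i + 2 + 2 * j : ℕ) : ℤ) - ((i + 1 : ℕ) : ℤ) - 1) / 2 = (j : ℤ) := by omega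
    have e2 : (((i + 1 : ℕ) : ℤ) - ((i + 2 + 2 * j : ℕ) : ℤ) - 1) / 2 = -((j + 1 : ℕ) : ℤ) := by
      omega
    rw [e1, e2, zpow_neg, zpow_natCast, zpow_natCast, ← inv_pow, pow_succ _ j,
      show i + 2 + 2 * j = i + 1 + 1 + 2 * j by ring, pow_add _ (i + 1 + 1), pow_mul, neg_one_sq,
      one_pow]
    ring
  · simp

/-- `θ · ((1−w)⁻¹ + Σ_{n,m≥1, n+m odd} (−1)ⁿ q^{nm/2} w^{(m−n−1)/2}) = 1` in `K[[q]]`: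
each `q`-coefficient of `θ·S` (computed with any sufficiently long partial product
for `θ`) agrees with the corresponding coefficient of `1`. -/
theorem stmt_13 :
    ∀ d m : ℕ, d ≤ m →
      PowerSeries.coeff (R := RatFunc ℚ) d (thetaPartial m * krSum) =
        PowerSeries.coeff (R := RatFunc ℚ) d 1 := by
  intro d m hdm
  set w : PowerSeries (RatFunc ℚ) := C RatFunc.X with hw
  set v : PowerSeries (RatFunc ℚ) := C (RatFunc.X)⁻¹ with hv
  set a : ℕ → PowerSeries (RatFunc ℚ) := fun n => (1 - w * X ^ (n + 1))⁻¹
  set b : ℕ → PowerSeries (RatFunc ℚ) := fun n => (1 - v * X ^ (n + 1))⁻¹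
  set e : ℕ → PowerSeries (RatFunc ℚ) := fun n => (1 - X ^ (n + 1))⁻¹
  set r : ℕ → PowerSeries (RatFunc ℚ) := fun n => ∏ i ∈ Finset.range n, e i with hr_def
  have hwv : w * v = 1 := by
    rw [hw, hv, ← map_mul, mul_inv_cancel₀ RatFunc.X_ne_zero, map_one]
  have ha : ∀ n, a n * (1 - w * X ^ (n + 1)) = 1 := one_sub_C_mul_X_pow_inv_mul _
  have hb : ∀ n, b n * (1 - v * X ^ (n + 1)) = 1 := one_sub_C_mul_X_pow_inv_mul _
  have he : ∀ n, e n * (1 - X ^ (n + 1)) = 1 := one_sub_X_pow_inv_mul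
  have hr : ∀ n, r (n + 1) * (1 - X ^ (n + 1)) = r n := fun n => by
    simp only [hr_def]
    rw [Finset.prod_range_succ, mul_assoc, he, mul_one]
  have hfin := finite_partial_fractions (by simp [hr_def]) hr he hwv ha hb m
  set S := C (1 - RatFunc.X : RatFunc ℚ)⁻¹ + ∑ i ∈ Finset.range m,
      (-1) ^ (i + 1) * X ^ triangular (i + 1) * (a i - v * b i) with hS
  have hinv : (1 - w) * C (1 - RatFunc.X : RatFunc ℚ)⁻¹ = 1 := by
    have hne : (1 - RatFunc.X : RatFunc ℚ) ≠ 0 := by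
      rw [sub_ne_zero, ← RatFunc.algebraMap_X, ← map_one (algebraMap (Polynomial ℚ) (RatFunc ℚ))]
      exact fun h => Polynomial.X_ne_C 1 (RatFunc.algebraMap_injective ℚ h).symm
    rw [hw, ← map_one C, ← map_sub, ← map_mul, mul_inv_cancel₀ hne]
  set E := ∏ n ∈ Finset.range m, (1 - w * X ^ (n + 1)) * (1 - v * X ^ (n + 1))
  have htheta : thetaPartial m = (1 - w) * (E * r m ^ 2) := by
    rw [thetaPartial, Finset.prod_mul_distrib, ← Finset.prod_pow]
  have hkr : X ^ (m + 1) ∣ krSum - S := by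
    rw [X_pow_dvd_iff]
    intro k hk
    rw [map_sub, coeff_krSum (Nat.lt_succ_iff.1 hk), sub_self]
  have hSdvd : X ^ (m + 1) ∣ thetaPartial m * S - 1 := by
    rw [← hfin, htheta]
    have hrw : (1 - w) * (E * r m ^ 2) * S = E * (r m ^ 2 + ∑ i ∈ Finset.range m,
        (-1) ^ (i + 1) * X ^ triangular (i + 1) * (1 + X ^ (i + 1)) * ((1 - w) * (1 - v)) *
          r m ^ 2 * (a i * b i)) := by
      have hsum : ∑ i ∈ Finset.range m,
          (-1) ^ (i + 1) * X ^ triangular (i + 1) * (1 + X ^ (i + 1)) * ((1 - w) * (1 - v)) *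
            r m ^ 2 * (a i * b i) = (1 - w) * r m ^ 2 * ∑ i ∈ Finset.range m,
          (-1) ^ (i + 1) * X ^ triangular (i + 1) * (a i - v * b i) := by
        rw [Finset.mul_sum]
        refine Finset.sum_congr rfl fun i _ => ?_
        have hab : a i - v * b i = (1 - v) * (1 + X ^ (i + 1)) * (a i * b i) := by
          linear_combination v * b i * ha i - a i * hb i + a i * b i * X ^ (i + 1) * hwv
        rw [hab]
        ring
      rw [hsum, hS]
      linear_combination E * r m ^ 2 * hinv
    rw [hrw, ← mul_sub, add_sub_add_left_eq_sub, ← Finset.sum_sub_distrib]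
    refine Dvd.dvd.mul_left (Finset.dvd_sum fun i hi => ?_) _
    have h := X_pow_dvd_X_pow_triangular_mul hr (Nat.succ_le_of_lt (Finset.mem_range.1 hi))
    convert h.mul_right ((-1) ^ (i + 1) * (1 + X ^ (i + 1)) * ((1 - w) * (1 - v)) * (a i * b i))
      using 1
    simp only [Nat.succ_eq_add_one]
    ring
  have hdvd : X ^ (m + 1) ∣ thetaPartial m * krSum - 1 := by
    have h : thetaPartial m * krSum - 1 =
        thetaPartial m * (krSum - S) + (thetaPartial m * S - 1) := by ring
    rw [h]
    exact dvd_add (hkr.mul_left _) hSdvd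
  have h := (X_pow_dvd_iff.1 hdvd) d (Nat.lt_succ_of_le hdm)
  rwa [map_sub, sub_eq_zero] at h
end

section
/- In the ring ℚ[[u,T]] of formal power series in two variables u and T over ℚ, the following identity holds: ∏_{n≥1} (1 − Tⁿ)² · ( (1 − e^u Tⁿ)(1 − e^{−u} Tⁿ) )^{−1} = u^{−1}(e^{u/2} − e^{−u/2}) · exp( 2 Σ_{k ≥ 2, k even} G_k(T) · u^k / k! ), where G_k(T) := −B_k/(2k) + Σ_{n≥1} ( Σ_{d ∣ n} d^{k−1} ) Tⁿ is the classical Eisenstein series, B_k the k-th Bernoulli number. -/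
open PowerSeries

/-- `ℚ[[u]]`, the coefficient ring (series in `u`); the ambient ring of the identity
is `ℚ[[u,T]] = Au[[T]]` with `T` the outer variable. -/
abbrev Au : Type := PowerSeries ℚ

/-- `e^u ∈ ℚ[[u]]`. -/
noncomputable def expu : Au := PowerSeries.exp ℚ

/-- `e^{−u} ∈ ℚ[[u]]`. -/
noncomputable def expNegu : Au := PowerSeries.rescale (-1 : ℚ) (PowerSeries.exp ℚ)

/-- `u⁻¹(e^{u/2} − e^{−u/2}) = Σ_{j≥0} u^{2j}/(2^{2j}(2j+1)!) ∈ ℚ[[u]]`,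
i.e. the coefficient of `u^m` is `1/(2^m (m+1)!)` for even `m` and `0` for odd `m`. -/
noncomputable def sinhFac : Au :=
  PowerSeries.mk fun m =>
    if Even m then ((2 : ℚ) ^ m * (Nat.factorial (m + 1) : ℚ))⁻¹ else 0

/-- The argument `2 Σ_{k≥2 even} G_k(T) u^k/k!` of the exponential, as an element of
`Au[[T]]`: its `T^N u^k`-coefficient is `2·g_k(N)/k!` for even `k ≥ 2`, where
`g_k(0) = −B_k/(2k)` and `g_k(N) = Σ_{d∣N} d^{k−1}` for `N ≥ 1`. -/
noncomputable def eisArg : PowerSeries Au :=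
  PowerSeries.mk fun N =>
    PowerSeries.mk fun j =>
      if 2 ≤ j ∧ Even j then
        2 * (if N = 0 then -(bernoulli j) / (2 * (j : ℚ))
             else ∑ d ∈ Nat.divisors N, (d : ℚ) ^ (j - 1)) / (Nat.factorial j : ℚ)
      else 0

/-- `exp(eisArg) = Σ_{t≥0} eisArg^t / t!`: since `eisArg` has `u`-order `≥ 2`, each
`u^j`-coefficient only receives contributions from `t ≤ j`, so the sum below is the
exponential. -/
noncomputable def expEisArg : PowerSeries Au :=
  PowerSeries.mk fun N =>
    PowerSeries.mk fun j =>
      ∑ t ∈ Finset.range (j + 1),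
        (Nat.factorial t : ℚ)⁻¹ *
          PowerSeries.coeff (R := ℚ) j (PowerSeries.coeff (R := Au) N (eisArg ^ t))

/-- The `n`-th factor `(1−Tⁿ)²·((1−e^uTⁿ)(1−e^{−u}Tⁿ))⁻¹` of the left-hand side;
the inverse is the genuine inverse of a power series with constant term `1`. -/
noncomputable def lhsFactor (n : ℕ) : PowerSeries Au :=
  (1 - (PowerSeries.X : PowerSeries Au) ^ n) ^ 2 *
    PowerSeries.invOfUnit
      ((1 - PowerSeries.C (R := Au) expu * PowerSeries.X ^ n) *
       (1 - PowerSeries.C (R := Au) expNegu * PowerSeries.X ^ n)) 1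

theorem PowerSeries.derivative_mul {R : Type*} [CommRing R] (f g : PowerSeries R) :
    d⁄dX R (f * g) = f * d⁄dX R g + g * d⁄dX R f := by
  rw [Derivation.leibniz, smul_eq_mul, smul_eq_mul]

/-- The partial sum `∑_{t ≤ M} x ^ t / t!` of the exponential series. -/
noncomputable def expPartialSum {A : Type*} [CommRing A] [Algebra ℚ A] (M : ℕ) (x : A) : A :=
  ∑ t ∈ Finset.range (M + 1), (Nat.factorial t : ℚ)⁻¹ • x ^ t

theorem derivative_expPartialSum_succ {R : Type*} [CommRing R] [Algebra ℚ (PowerSeries R)]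
    (M : ℕ) (x : PowerSeries R) :
    d⁄dX R (expPartialSum (M + 1) x) = expPartialSum M x * d⁄dX R x := by
  unfold expPartialSum
  rw [Finset.sum_range_succ', map_add, map_sum, Finset.sum_mul]
  have h0 : d⁄dX R ((Nat.factorial 0 : ℚ)⁻¹ • x ^ 0) = 0 := by simp
  rw [h0, add_zero]
  refine Finset.sum_congr rfl fun t _ => ?_
  rw [map_rat_smul, Derivation.leibniz_pow, Nat.add_sub_cancel, ← Nat.cast_smul_eq_nsmul ℚ,
    smul_smul, smul_eq_mul, smul_mul_assoc]
  congr 1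
  rw [Nat.factorial_succ]
  push_cast
  have : (t : ℚ) + 1 ≠ 0 := by positivity
  field_simp

theorem map_expPartialSum {A B : Type*} [CommRing A] [Algebra ℚ A] [CommRing B] [Algebra ℚ B]
    (f : A →+* B) (M : ℕ) (x : A) : f (expPartialSum M x) = expPartialSum M (f x) := by
  simp [expPartialSum, map_sum, map_rat_smul, map_pow]

theorem C_X_dvd_eisArg : C (R := Au) X ∣ eisArg := by
  refine ⟨mk fun N => mk fun j => coeff (j + 1) (coeff N eisArg), ?_⟩
  ext N j
  rw [coeff_C_mul, coeff_mk]
  cases j with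
  | zero => simp [eisArg]
  | succ j => rw [coeff_succ_X_mul, coeff_mk]

theorem coeff_eisArg_pow_eq_zero {j t : ℕ} (h : j < t) (N : ℕ) :
    coeff j (coeff N (eisArg ^ t)) = 0 := by
  obtain ⟨g, hg⟩ := pow_dvd_pow_of_dvd C_X_dvd_eisArg t
  rw [hg, ← map_pow, coeff_C_mul, coeff_X_pow_mul', if_neg (by lia)]

theorem coeff_expEisArg {j M : ℕ} (h : j ≤ M) (N : ℕ) :
    coeff j (coeff N expEisArg) = coeff j (coeff N (expPartialSum M eisArg)) := by
  rw [expEisArg, coeff_mk, coeff_mk, expPartialSum, map_sum, map_sum]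
  refine (Finset.sum_subset (Finset.range_mono (by lia)) fun t _ ht => ?_).trans
    (Finset.sum_congr rfl fun t _ => ?_)
  · rw [coeff_eisArg_pow_eq_zero (by simpa using ht), mul_zero]
  · rw [map_rat_smul, map_rat_smul, smul_eq_mul]

theorem derivative_expEisArg : d⁄dX Au expEisArg = expEisArg * d⁄dX Au eisArg := by
  ext N j
  have h : coeff j (coeff N (d⁄dX Au expEisArg)) =
      coeff j (coeff N (d⁄dX Au (expPartialSum (j + 1) eisArg))) := by
    rw [coeff_derivative, coeff_derivative, ← Nat.cast_succ, ← nsmul_eq_mul', ← nsmul_eq_mul',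
      map_nsmul, map_nsmul, coeff_expEisArg j.le_succ]
  rw [h, derivative_expPartialSum_succ, coeff_mul, coeff_mul, map_sum, map_sum]
  refine Finset.sum_congr rfl fun p _ => ?_
  rw [coeff_mul, coeff_mul]
  refine Finset.sum_congr rfl fun q hq => ?_
  rw [coeff_expEisArg (show q.1 ≤ j by
    have := Finset.HasAntidiagonal.mem_antidiagonal.mp hq
    lia)]

theorem derivative_coeff_zero_expEisArg :
    d⁄dX ℚ (coeff 0 expEisArg) = coeff 0 expEisArg * d⁄dX ℚ (coeff 0 eisArg) := by
  have hT (M : ℕ) : coeff 0 (expPartialSum M eisArg) = expPartialSum M (coeff 0 eisArg) :=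
    by simpa using map_expPartialSum (constantCoeff (R := Au)) M eisArg
  ext j
  rw [coeff_derivative, coeff_expEisArg le_rfl, hT, ← coeff_derivative,
    derivative_expPartialSum_succ, coeff_mul, coeff_mul]
  refine Finset.sum_congr rfl fun q hq => ?_
  rw [coeff_expEisArg (show q.1 ≤ j by
    have := Finset.HasAntidiagonal.mem_antidiagonal.mp hq
    lia), hT]

theorem coeff_zero_coeff_zero_expEisArg : coeff 0 (coeff 0 expEisArg) = 1 := by
  simp [expEisArg]

theorem derivative_rescale_exp (a : ℚ) :
    d⁄dX ℚ (rescale a (exp ℚ)) = a • rescale a (exp ℚ) := by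
  ext n
  simp only [coeff_derivative, coeff_rescale, coeff_exp, coeff_smul, Nat.factorial_succ,
    Algebra.algebraMap_self, RingHom.id_apply, smul_eq_mul]
  push_cast
  have : (n : ℚ) + 1 ≠ 0 := by positivity
  field_simp
  ring

theorem X_mul_sinhFac :
    X * sinhFac = rescale (1 / 2 : ℚ) (exp ℚ) - rescale (-(1 / 2) : ℚ) (exp ℚ) := by
  ext n
  cases n with
  | zero => rw [map_sub, coeff_rescale, coeff_rescale]; simp
  | succ n =>
    rw [coeff_succ_X_mul]
    simp only [sinhFac, coeff_mk, map_sub, coeff_rescale, coeff_exp, Algebra.algebraMap_self,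
      RingHom.id_apply]
    have hf : ((n + 1).factorial : ℚ) ≠ 0 := by positivity
    rcases Nat.even_or_odd n with h | h
    · rw [if_pos h, h.add_one.neg_pow, pow_succ, div_pow, one_pow]
      field_simp
      norm_num
    · rw [if_neg (Nat.not_even_iff_odd.mpr h), h.add_one.neg_pow]
      ring

theorem X_mul_derivative_coeff_zero_eisArg :
    X * d⁄dX ℚ (coeff 0 eisArg) = 1 - C (1 / 2 : ℚ) * X - bernoulliPowerSeries ℚ := by
  ext n
  simp only [map_sub, coeff_C_mul, coeff_one, bernoulliPowerSeries, coeff_mk, coeff_X,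
    Algebra.algebraMap_self, RingHom.id_apply]
  rcases n with _ | _ | n
  · simp
  · rw [coeff_succ_X_mul, coeff_derivative]
    norm_num [eisArg]
  · rw [coeff_succ_X_mul, coeff_derivative]
    simp only [eisArg, coeff_mk]
    by_cases h : Even (n + 1 + 1)
    · rw [if_pos ⟨by lia, h⟩]
      simp only [if_true, if_neg (show ¬ n + 1 + 1 = 0 by lia),
        if_neg (show ¬ n + 1 + 1 = 1 by lia)]
      push_cast
      have h1 : (n : ℚ) + 1 + 1 ≠ 0 := by positivity
      have hf : ((n + 1 + 1).factorial : ℚ) ≠ 0 := by positivity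
      field_simp
      ring
    · rw [if_neg (fun h' => h h'.2),
        bernoulli_eq_zero_of_odd (Nat.not_even_iff_odd.mp h) (by lia)]
      simp

theorem derivative_sinhFac :
    d⁄dX ℚ sinhFac = -(sinhFac * d⁄dX ℚ (coeff 0 eisArg)) := by
  have hS := X_mul_sinhFac
  have hc := X_mul_derivative_coeff_zero_eisArg
  have hB := bernoulliPowerSeries_mul_exp_sub_one ℚ
  have hD := congrArg (d⁄dX ℚ) hS
  rw [Derivation.leibniz, map_sub, derivative_rescale_exp, derivative_rescale_exp, derivative_X,
    smul_eq_C_mul, smul_eq_C_mul, smul_eq_mul, smul_eq_mul, map_neg] at hD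
  have hE : exp ℚ * rescale (-(1 / 2) : ℚ) (exp ℚ) = rescale (1 / 2 : ℚ) (exp ℚ) := by
    have := exp_mul_exp_eq_exp_add (A := ℚ) 1 (-(1 / 2))
    rw [rescale_one] at this
    norm_num at this ⊢
    exact this
  have h2 : C (1 / 2 : ℚ) + C (1 / 2 : ℚ) = 1 := by rw [← map_add]; norm_num
  have hX : (X : Au) ≠ 0 := X_ne_zero
  refine mul_left_cancel₀ (pow_ne_zero 2 hX) ?_
  generalize rescale (1 / 2 : ℚ) (exp ℚ) = e at *
  generalize rescale (-(1 / 2) : ℚ) (exp ℚ) = e' at *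
  linear_combination X * hD + X * sinhFac * hc - hS +
    (1 - C (1 / 2 : ℚ) * X - bernoulliPowerSeries ℚ) * hS +
    bernoulliPowerSeries ℚ * hE - e' * hB + X * e' * h2

theorem sinhFac_mul_coeff_zero_expEisArg : sinhFac * coeff 0 expEisArg = 1 := by
  refine derivative.ext ?_ ?_
  · rw [Derivation.leibniz, derivative_coeff_zero_expEisArg, derivative_sinhFac, derivative_one,
      smul_eq_mul, smul_eq_mul]
    ring
  · rw [map_mul, ← coeff_zero_eq_constantCoeff_apply, ← coeff_zero_eq_constantCoeff_apply,
      coeff_zero_coeff_zero_expEisArg]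
    simp [sinhFac]

theorem coeff_eq_of_X_mul_derivative_eq {R : Type*} [CommRing R] [IsDomain R] [CharZero R]
    {P Q A B : PowerSeries R} {m : ℕ} (hP : X * d⁄dX R P = A * P) (hQ : X * d⁄dX R Q = B * Q)
    (hA : coeff 0 A = 0) (hAB : ∀ i ≤ m, coeff i A = coeff i B) (h0 : coeff 0 P = coeff 0 Q) :
    ∀ d ≤ m, coeff d P = coeff d Q := by
  intro d
  induction d using Nat.strong_induction_on with
  | _ d ih =>
    intro hd
    rcases d with _ | d
    · exact h0
    have hP' := congrArg (coeff (d + 1)) hP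
    have hQ' := congrArg (coeff (d + 1)) hQ
    rw [coeff_succ_X_mul, coeff_derivative, coeff_mul] at hP' hQ'
    have hne : (d : R) + 1 ≠ 0 := Nat.cast_add_one_ne_zero d
    refine mul_right_cancel₀ hne ?_
    rw [hP', hQ']
    refine Finset.sum_congr rfl fun p hp => ?_
    have hp' := Finset.HasAntidiagonal.mem_antidiagonal.mp hp
    rw [← hAB p.1 (by lia)]
    rcases Nat.eq_zero_or_pos p.1 with h | h
    · rw [h, hA, zero_mul, zero_mul]
    · rw [ih p.2 (by lia) (by lia)]

/-- The expansion `∑_{d ≥ 1} a ^ d T ^ (n d)` of `a T ^ n / (1 - a T ^ n)`. -/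
noncomputable def geomTail {R : Type*} [CommRing R] (a : R) (n : ℕ) : PowerSeries R :=
  mk fun N => if n ∣ N ∧ N ≠ 0 then a ^ (N / n) else 0

theorem geomTail_mul {R : Type*} [CommRing R] (a : R) {n : ℕ} (hn : 0 < n) :
    geomTail a n * (1 - C a * X ^ n) = C a * X ^ n := by
  ext N
  rw [mul_sub, mul_one, mul_left_comm, map_sub, coeff_C_mul, coeff_C_mul, coeff_mul_X_pow',
    coeff_X_pow, geomTail, coeff_mk, coeff_mk]
  rcases lt_trichotomy N n with h | rfl | h
  · rw [if_neg (not_le.mpr h), if_neg h.ne, if_neg]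
    · simp
    · rintro ⟨h1, h2⟩
      exact h2 (Nat.eq_zero_of_dvd_of_lt h1 h)
  · simp [hn.ne', Nat.div_self hn]
  · have hdiv : (N - n) / n + 1 = N / n := by
      rw [Nat.div_eq_sub_div hn h.le]
    rw [if_pos h.le, if_neg h.ne']
    by_cases hd : n ∣ N
    · rw [if_pos ⟨hd, by lia⟩, if_pos ⟨Nat.dvd_sub hd dvd_rfl, by lia⟩, ← hdiv, pow_succ]
      ring
    · rw [if_neg (fun h' => hd h'.1), if_neg]
      · simp
      · rintro ⟨h1, _⟩
        exact hd ((Nat.dvd_sub_iff_left h.le dvd_rfl).mp h1)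

theorem X_mul_derivative_one_sub {R : Type*} [CommRing R] (a : R) {n : ℕ} (hn : 0 < n) :
    X * d⁄dX R (1 - C a * X ^ n) = -((n : PowerSeries R) * geomTail a n * (1 - C a * X ^ n)) := by
  rw [mul_assoc, geomTail_mul a hn, map_sub, derivative_one, Derivation.leibniz, derivative_C,
    derivative_pow, derivative_X]
  obtain ⟨k, rfl⟩ := Nat.exists_eq_succ_of_ne_zero hn.ne'
  simp only [Nat.succ_eq_add_one, Nat.add_sub_cancel, smul_eq_mul]
  ring

/-- The logarithmic derivative `T f' / f` of the `n`-th factor `f`. -/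
noncomputable def lhsLogDeriv (n : ℕ) : PowerSeries Au :=
  (n : PowerSeries Au) * (geomTail expu n + geomTail expNegu n - 2 * geomTail 1 n)

theorem lhsFactor_mul {n : ℕ} (hn : 0 < n) :
    lhsFactor n * ((1 - C expu * X ^ n) * (1 - C expNegu * X ^ n)) =
      (1 - C (1 : Au) * X ^ n) ^ 2 := by
  rw [lhsFactor, mul_assoc, mul_comm (invOfUnit _ _), mul_invOfUnit, mul_one, map_one, one_mul]
  simp [hn.ne']

theorem one_sub_C_mul_X_pow_ne_zero (a : Au) {n : ℕ} (hn : 0 < n) :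
    (1 - C a * X ^ n : PowerSeries Au) ≠ 0 := by
  intro h
  simpa [hn.ne'] using congrArg (constantCoeff (R := Au)) h

theorem X_mul_derivative_lhsFactor {n : ℕ} (hn : 0 < n) :
    X * d⁄dX Au (lhsFactor n) = lhsLogDeriv n * lhsFactor n := by
  have h := lhsFactor_mul hn
  have h' := congrArg (d⁄dX Au) h
  have h1 := X_mul_derivative_one_sub expu hn
  have h2 := X_mul_derivative_one_sub expNegu hn
  have h3 := X_mul_derivative_one_sub (1 : Au) hn
  have hne := mul_ne_zero (one_sub_C_mul_X_pow_ne_zero expu hn)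
    (one_sub_C_mul_X_pow_ne_zero expNegu hn)
  rw [sq] at h h'
  simp only [PowerSeries.derivative_mul] at h'
  refine mul_right_cancel₀ hne ?_
  unfold lhsLogDeriv
  generalize (1 - C expu * X ^ n : PowerSeries Au) = p at *
  generalize (1 - C expNegu * X ^ n : PowerSeries Au) = q at *
  generalize (1 - C (1 : Au) * X ^ n : PowerSeries Au) = r at *
  linear_combination X * h' - lhsFactor n * q * h1 - lhsFactor n * p * h2 + 2 * r * h3 +
    2 * (n : PowerSeries Au) * geomTail 1 n * h

theorem X_mul_derivative_prod_lhsFactor (m : ℕ) :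
    X * d⁄dX Au (∏ n ∈ Finset.range m, lhsFactor (n + 1)) =
      (∑ n ∈ Finset.range m, lhsLogDeriv (n + 1)) * ∏ n ∈ Finset.range m, lhsFactor (n + 1) := by
  induction m with
  | zero => simp
  | succ m ih =>
    rw [Finset.prod_range_succ, Finset.sum_range_succ, PowerSeries.derivative_mul]
    linear_combination (∏ n ∈ Finset.range m, lhsFactor (n + 1)) *
      X_mul_derivative_lhsFactor m.succ_pos + lhsFactor (m + 1) * ih

theorem constantCoeff_lhsFactor {n : ℕ} (hn : 0 < n) :
    constantCoeff (lhsFactor n) = 1 := by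
  have h := congrArg (constantCoeff (R := Au)) (lhsFactor_mul hn)
  simpa [hn.ne'] using h

theorem coeff_expu_pow_add_expNegu_pow_sub_two (d j : ℕ) :
    coeff j (expu ^ d + expNegu ^ d - 2) =
      if 2 ≤ j ∧ Even j then 2 * (d : ℚ) ^ j / (j.factorial : ℚ) else 0 := by
  have h2 : (2 : Au) = C (2 : ℚ) := rfl
  rw [expu, expNegu, ← map_pow, exp_pow_eq_rescale_exp, map_sub, map_add, coeff_rescale,
    coeff_rescale, coeff_rescale, h2, coeff_C, coeff_exp]
  simp only [Algebra.algebraMap_self, RingHom.id_apply]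
  rcases j with _ | _ | j
  · norm_num
  · norm_num
  · by_cases h : Even (j + 1 + 1)
    · rw [if_neg (j + 1).succ_ne_zero, if_pos ⟨by lia, h⟩, h.neg_one_pow]
      ring
    · rw [if_neg (j + 1).succ_ne_zero, if_neg (fun h' => h h'.2),
        (Nat.not_even_iff_odd.mp h).neg_one_pow]
      ring

theorem coeff_lhsLogDeriv (n N : ℕ) :
    coeff N (lhsLogDeriv n) =
      if n ∣ N ∧ N ≠ 0 then (n : Au) * (expu ^ (N / n) + expNegu ^ (N / n) - 2) else 0 := by
  have hn : (n : PowerSeries Au) = C (n : Au) := (map_natCast _ _).symm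
  have h2 : (2 : PowerSeries Au) = C (2 : Au) := rfl
  rw [lhsLogDeriv, hn, h2, coeff_C_mul, map_sub, map_add, coeff_C_mul]
  simp only [geomTail, coeff_mk]
  split_ifs <;> simp

theorem coeff_sum_lhsLogDeriv {N m : ℕ} (h : N ≤ m) :
    coeff N (∑ n ∈ Finset.range m, lhsLogDeriv (n + 1)) = coeff N (X * d⁄dX Au eisArg) := by
  rw [map_sum]
  rcases N with _ | N
  · simp [coeff_lhsLogDeriv]
  have hdiv : ∑ n ∈ Finset.range m, coeff (N + 1) (lhsLogDeriv (n + 1)) =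
      ∑ n ∈ (N + 1).divisors,
        (((N + 1) / n : ℕ) : Au) * (expu ^ n + expNegu ^ n - 2) := by
    rw [← Nat.sum_div_divisors, Finset.range_eq_Ico,
      Finset.sum_Ico_add' (fun n => coeff (N + 1) (lhsLogDeriv n)) 0 m 1]
    simp only [coeff_lhsLogDeriv, ne_eq, Nat.add_eq_zero_iff, one_ne_zero, and_false,
      not_false_eq_true, and_true]
    rw [← Finset.sum_filter]
    refine Finset.sum_congr ?_ fun n hn => ?_
    · ext n
      simp only [Finset.mem_filter, Finset.mem_Ico, Nat.mem_divisors]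
      constructor
      · rintro ⟨_, h2⟩
        exact ⟨h2, by lia⟩
      · rintro ⟨h1, _⟩
        have := Nat.le_of_dvd N.succ_pos h1
        have := Nat.pos_of_dvd_of_pos h1 N.succ_pos
        exact ⟨by lia, h1⟩
    · rw [Nat.div_div_self (Nat.dvd_of_mem_divisors hn) N.succ_ne_zero]
  rw [hdiv, coeff_succ_X_mul, coeff_derivative, ← Nat.cast_succ, ← nsmul_eq_mul']
  ext j
  simp only [map_sum, ← nsmul_eq_mul, map_nsmul, coeff_expu_pow_add_expNegu_pow_sub_two, eisArg,
    coeff_mk, Nat.succ_eq_add_one, if_neg N.succ_ne_zero]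
  split_ifs with hj
  · rw [Finset.mul_sum, Finset.sum_div, Finset.smul_sum]
    refine Finset.sum_congr rfl fun d hd => ?_
    obtain ⟨k, hk⟩ := Nat.dvd_of_mem_divisors hd
    have hd0 : 0 < d := Nat.pos_of_mem_divisors hd
    obtain ⟨i, rfl⟩ : ∃ i, j = i + 1 := ⟨j - 1, by lia⟩
    rw [hk, Nat.mul_div_cancel_left _ hd0, nsmul_eq_mul, nsmul_eq_mul, Nat.add_sub_cancel]
    push_cast
    ring
  · simp

/-- The identity `∏_{n≥1}(1−Tⁿ)²((1−e^uTⁿ)(1−e^{−u}Tⁿ))⁻¹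
= u⁻¹(e^{u/2}−e^{−u/2})·exp(2Σ_{k≥2 even} G_k(T)u^k/k!)` in `ℚ[[u,T]]`, the infinite
product taken `T`-adically: each `T`-coefficient of the two sides agrees once the
partial product includes all factors of index up to that degree. -/
theorem stmt_14 :
    ∀ d m : ℕ, d ≤ m →
      PowerSeries.coeff (R := Au) d (∏ n ∈ Finset.range m, lhsFactor (n + 1)) =
        PowerSeries.coeff (R := Au) d (PowerSeries.C (R := Au) sinhFac * expEisArg) := by
  intro d m hdm
  have hQ : X * d⁄dX Au (C sinhFac * expEisArg) =
      (X * d⁄dX Au eisArg) * (C sinhFac * expEisArg) := by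
    rw [PowerSeries.derivative_mul, derivative_C, derivative_expEisArg, mul_zero, add_zero]
    ring
  have : CharZero Au := algebraRat.charZero Au
  refine coeff_eq_of_X_mul_derivative_eq (X_mul_derivative_prod_lhsFactor m) hQ ?_
    (fun i hi => coeff_sum_lhsLogDeriv hi) ?_ d hdm
  · rw [coeff_sum_lhsLogDeriv m.zero_le, coeff_zero_X_mul]
  · rw [coeff_C_mul, sinhFac_mul_coeff_zero_expEisArg, coeff_zero_eq_constantCoeff_apply, map_prod]
    exact Finset.prod_eq_one fun n _ => constantCoeff_lhsFactor n.succ_pos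
end

section
/- For every integer i ≥ 1, the following identity holds in the ring of formal power series in T with coefficients in ℤ[z]: ( Σ_{λ ∈ 𝒫} z^{λᵢ} T^{|λ|} ) · ∏_{k=1}^{i−1} (1 − Tᵏ) · ∏_{n≥1} (1 − z T^{n+i−1}) = 1, where the infinite product is taken in the T-adic (coefficientwise) topology. -/
/-- The `i`-th part (1-indexed) of a partition `λ ⊢ N`, read off from the decreasingly
sorted list of its parts (`0` if `i` exceeds the number of parts). -/
noncomputable def nthPartVal (i : ℕ) {N : ℕ} (lam : Nat.Partition N) : ℕ :=
  ((lam.parts.sort (· ≤ ·)).reverse).getD (i - 1) 0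

/-- The series `Σ_{λ ∈ 𝒫} z^{λᵢ} T^{|λ|} ∈ ℤ[z][[T]]`. -/
noncomputable def zSeries (i : ℕ) : PowerSeries (Polynomial ℤ) :=
  PowerSeries.mk fun N => ∑ lam : Nat.Partition N, (Polynomial.X : Polynomial ℤ) ^ nthPartVal i lam

namespace YoungDiagram

theorem card_eq_sum_rowLens (μ : YoungDiagram) : μ.card = μ.rowLens.sum := by
  have h : ∀ c ∈ μ.cells, c.1 ∈ Finset.range (μ.colLen 0) := fun c hc => by
    rw [Finset.mem_range, ← mem_iff_lt_colLen]
    exact μ.up_left_mem le_rfl (Nat.zero_le _) ((mem_cells c).1 hc)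
  rw [YoungDiagram.card, Finset.card_eq_sum_card_fiberwise h, rowLens]
  change _ = ∑ r ∈ Finset.range (μ.colLen 0), μ.rowLen r
  exact Finset.sum_congr rfl fun r _ => (μ.rowLen_eq_card).symm

theorem card_transpose (μ : YoungDiagram) : μ.transpose.card = μ.card := by
  simp [YoungDiagram.card, transpose]

/-- The number of rows of length greater than `j` is the length of the `j`-th column. -/
theorem card_filter_rowLens (μ : YoungDiagram) (j : ℕ) :
    ((μ.rowLens : Multiset ℕ).filter (j + 1 ≤ ·)).card = μ.colLen j := by
  have h : (Multiset.range (μ.colLen 0)).filter (fun r => j + 1 ≤ μ.rowLen r) =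
      ((Finset.range (μ.colLen 0)).filter (fun r => j + 1 ≤ μ.rowLen r)).val := rfl
  have h' : (Finset.range (μ.colLen 0)).filter (fun r => j + 1 ≤ μ.rowLen r) =
      Finset.range (μ.colLen j) := by
    ext r
    have := μ.colLen_anti 0 j (Nat.zero_le j)
    simp only [Finset.mem_filter, Finset.mem_range, Nat.succ_le_iff, ← mem_iff_lt_rowLen,
      mem_iff_lt_colLen]
    lia
  rw [rowLens, ← Multiset.map_coe, Multiset.filter_map, Multiset.card_map]
  change ((Multiset.range (μ.colLen 0)).filter (fun r => j + 1 ≤ μ.rowLen r)).card = _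
  rw [h, h', Finset.card_val, Finset.card_range]

theorem getD_rowLens (μ : YoungDiagram) (j : ℕ) : μ.rowLens.getD j 0 = μ.rowLen j := by
  by_cases h : j < μ.rowLens.length
  · rw [List.getD_eq_getElem _ _ h, get_rowLens]
  · rw [List.getD_eq_default _ _ (not_lt.1 h)]
    rw [length_rowLens, ← mem_iff_lt_colLen, mem_iff_lt_rowLen] at h
    lia

end YoungDiagram

namespace Nat.Partition

variable {N : ℕ}

/-- The Young diagram whose row lengths are the parts of a partition. -/
noncomputable def youngDiagram (p : Nat.Partition N) : YoungDiagram :=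
  YoungDiagram.ofRowLens (p.parts.sort (· ≤ ·)).reverse
    (Multiset.pairwise_sort p.parts (· ≤ ·)).sortedLE.reverse

theorem rowLens_youngDiagram (p : Nat.Partition N) :
    p.youngDiagram.rowLens = (p.parts.sort (· ≤ ·)).reverse :=
  YoungDiagram.rowLens_ofRowLens_eq_self fun x hx => p.parts_pos (by simpa using hx)

theorem coe_rowLens_youngDiagram (p : Nat.Partition N) :
    (p.youngDiagram.rowLens : Multiset ℕ) = p.parts := by
  rw [rowLens_youngDiagram, Multiset.coe_reverse, Multiset.sort_eq]

theorem card_youngDiagram (p : Nat.Partition N) : p.youngDiagram.card = N := by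
  rw [YoungDiagram.card_eq_sum_rowLens, ← Multiset.sum_coe, coe_rowLens_youngDiagram, p.parts_sum]

/-- The conjugate partition. -/
noncomputable def conjugate (p : Nat.Partition N) : Nat.Partition N where
  parts := p.youngDiagram.transpose.rowLens
  parts_pos hx := YoungDiagram.pos_of_mem_rowLens _ _ (by simpa using hx)
  parts_sum := by
    rw [Multiset.sum_coe, ← YoungDiagram.card_eq_sum_rowLens, YoungDiagram.card_transpose,
      card_youngDiagram]

theorem youngDiagram_conjugate (p : Nat.Partition N) :
    p.conjugate.youngDiagram = p.youngDiagram.transpose := by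
  apply YoungDiagram.equivListRowLens.injective
  apply Subtype.ext
  refine List.Perm.eq_of_pairwise' (r := (· ≥ ·)) ?_ ?_ ?_
  · exact (YoungDiagram.rowLens_sorted _).pairwise
  · exact (YoungDiagram.rowLens_sorted _).pairwise
  · exact Multiset.coe_eq_coe.1 (coe_rowLens_youngDiagram p.conjugate)

theorem conjugate_involutive : Function.Involutive (conjugate (N := N)) := fun p => by
  apply Nat.Partition.ext
  rw [← coe_rowLens_youngDiagram, ← coe_rowLens_youngDiagram p, youngDiagram_conjugate,
    youngDiagram_conjugate, YoungDiagram.transpose_transpose]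

theorem nthPartVal_eq_card_filter_conjugate {i : ℕ} (hi : 1 ≤ i) (p : Nat.Partition N) :
    nthPartVal i p = (p.conjugate.parts.filter (i ≤ ·)).card := by
  obtain ⟨j, rfl⟩ := Nat.exists_eq_add_of_le' hi
  have h := YoungDiagram.card_filter_rowLens p.youngDiagram.transpose j
  rw [nthPartVal, ← rowLens_youngDiagram, Nat.add_sub_cancel, YoungDiagram.getD_rowLens,
    ← YoungDiagram.colLen_transpose, ← h]
  rfl

end Nat.Partition

theorem Multiset.prod_map_ite_one {R : Type*} [CommMonoid R] (s : Multiset ℕ) (q : ℕ → Prop)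
    [DecidablePred q] (x : R) :
    (s.map fun k => if q k then x else 1).prod = x ^ (s.filter q).card := by
  induction s using Multiset.induction_on with
  | empty => simp
  | cons a s ih => by_cases h : q a <;> simp [h, ih, pow_succ']

theorem zSeries_eq_genFun {i : ℕ} (hi : 1 ≤ i) :
    zSeries i = Nat.Partition.genFun
      (fun k j => (if i ≤ k then (Polynomial.X : Polynomial ℤ) else 1) ^ j) := by
  ext1 N
  rw [zSeries, PowerSeries.coeff_mk, Nat.Partition.coeff_genFun,
    ← Equiv.sum_comp (Nat.Partition.conjugate_involutive (N := N)).toPerm]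
  refine Finset.sum_congr rfl fun p _ => ?_
  rw [Nat.Partition.nthPartVal_eq_card_filter_conjugate hi, Function.Involutive.coe_toPerm,
    Nat.Partition.conjugate_involutive p, ← Multiset.prod_map_ite_one,
    Finset.prod_multiset_map_count]
  simp [Finsupp.prod]

open PowerSeries in
open scoped PowerSeries.WithPiTopology in
/-- The generating function with weight `w k` for each part `k` is inverse to `∏ (1 - w k X ^ k)`,
coefficient by coefficient. -/
theorem Nat.Partition.coeff_genFun_pow_mul_prod {R : Type*} [CommRing R] (w : ℕ → R) {d m : ℕ}
    (hdm : d ≤ m) :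
    PowerSeries.coeff d (genFun (fun k j => w k ^ j) *
      ∏ n ∈ Finset.range m, (1 - PowerSeries.C (w (n + 1)) * PowerSeries.X ^ (n + 1))) =
    PowerSeries.coeff d 1 := by
  let : TopologicalSpace R := ⊥
  have : DiscreteTopology R := ⟨rfl⟩
  set g : ℕ → PowerSeries R :=
    fun n => 1 + ∑' j, w (n + 1) ^ (j + 1) • PowerSeries.X ^ ((n + 1) * (j + 1)) with hg
  have hinv : ∀ n, g n * (1 - PowerSeries.C (w (n + 1)) * PowerSeries.X ^ (n + 1)) = 1 := by
    intro n
    have h0 : (PowerSeries.C (w (n + 1)) * PowerSeries.X ^ (n + 1)).constantCoeff = 0 := by simp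
    refine Eq.trans ?_ (WithPiTopology.tsum_pow_mul_one_sub_of_constantCoeff_eq_zero h0)
    rw [(WithPiTopology.summable_pow_of_constantCoeff_eq_zero h0).tsum_eq_zero_add, hg]
    simp [mul_pow, PowerSeries.smul_eq_C_mul, pow_mul]
  have hlim := ((WithPiTopology.continuous_coeff R d).tendsto _).comp
    (((hasProd_genFun (fun k j => w k ^ j)).tendsto_prod_nat).mul_const
      (∏ n ∈ Finset.range m, (1 - PowerSeries.C (w (n + 1)) * PowerSeries.X ^ (n + 1))))
  refine tendsto_nhds_unique hlim (tendsto_atTop_of_eventually_const (i₀ := m) fun N hN => ?_)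
  obtain ⟨r, rfl⟩ := Nat.exists_eq_add_of_le hN
  have htail : ∀ r, PowerSeries.X ^ (m + 1) ∣ (∏ n ∈ Finset.range r, g (m + n)) - 1 := by
    intro r
    induction r with
    | zero => simp
    | succ r ih =>
      obtain ⟨a, ha⟩ := ih
      rw [Finset.prod_range_succ]
      refine ⟨a * g (m + r) + g (m + r) * PowerSeries.C (w (m + r + 1)) * PowerSeries.X ^ r, ?_⟩
      linear_combination g (m + r) * ha + hinv (m + r)
  change PowerSeries.coeff d ((∏ n ∈ Finset.range (m + r), g n) * _) = _
  rw [Finset.prod_range_add, mul_right_comm, ← Finset.prod_mul_distrib,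
    Finset.prod_congr rfl fun n _ => hinv n, Finset.prod_const_one, one_mul, ← sub_eq_zero,
    ← map_sub]
  exact PowerSeries.X_pow_dvd_iff.1 (htail r) d (by lia)

/-- For every `i ≥ 1`, `(Σ_λ z^{λᵢ}T^{|λ|}) · ∏_{k=1}^{i−1}(1−Tᵏ) · ∏_{n≥1}(1−zT^{n+i−1}) = 1`
in `ℤ[z][[T]]`, the infinite product taken in the T-adic (coefficientwise) topology:
each `T`-coefficient of the left-hand side agrees with that of `1` once the partial
product includes all factors of index up to that degree. -/
theorem stmt_15 (i : ℕ) (hi : 1 ≤ i) :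
    ∀ d m : ℕ, d ≤ m →
      PowerSeries.coeff (R := Polynomial ℤ) d
        (zSeries i *
          (∏ k ∈ Finset.range (i - 1),
            (1 - (PowerSeries.X : PowerSeries (Polynomial ℤ)) ^ (k + 1))) *
          ∏ n ∈ Finset.range m,
            (1 - PowerSeries.C (R := Polynomial ℤ) Polynomial.X * PowerSeries.X ^ (n + i))) =
      PowerSeries.coeff (R := Polynomial ℤ) d 1 := by
  intro d m hdm
  have hlow : ∀ k ∈ Finset.range (i - 1),
      (1 - (PowerSeries.X : PowerSeries (Polynomial ℤ)) ^ (k + 1)) =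
        1 - PowerSeries.C (if i ≤ k + 1 then (Polynomial.X : Polynomial ℤ) else 1) *
          PowerSeries.X ^ (k + 1) := fun k hk => by
    have hk' : ¬ i ≤ k + 1 := by
      rw [Finset.mem_range] at hk
      lia
    rw [if_neg hk', map_one, one_mul]
  have hhigh : ∀ n ∈ Finset.range m,
      (1 - PowerSeries.C (R := Polynomial ℤ) Polynomial.X * PowerSeries.X ^ (n + i)) =
        1 - PowerSeries.C (if i ≤ i - 1 + n + 1 then (Polynomial.X : Polynomial ℤ) else 1) *
          PowerSeries.X ^ (i - 1 + n + 1) := fun n _ => by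
    rw [if_pos (by lia), show i - 1 + n + 1 = n + i by lia]
  rw [Finset.prod_congr rfl hlow, Finset.prod_congr rfl hhigh, mul_assoc,
    ← Finset.prod_range_add (fun k => 1 - PowerSeries.C
      (if i ≤ k + 1 then (Polynomial.X : Polynomial ℤ) else 1) * PowerSeries.X ^ (k + 1)),
    zSeries_eq_genFun hi]
  exact Nat.Partition.coeff_genFun_pow_mul_prod
    (fun k => if i ≤ k then (Polynomial.X : Polynomial ℤ) else 1)
    (hdm.trans (Nat.le_add_left m (i - 1)))
end

section
/- In the ring of formal power series in T with coefficients in the Laurent polynomial ring ℤ[q, q⁻¹], the following identity holds: ∏_{n≥1} (1 − Tⁿ)² = ( ∏_{n≥1} (1 − qTⁿ)(1 − q⁻¹Tⁿ) ) · ( 1 + Σ_{r,s ≥ 1, r + s odd} (−1)^r T^{rs/2} ( q^{(s−r−1)/2} − q^{(s−r+1)/2} ) ), where the infinite products are taken in the T-adic (coefficientwise) topology. -/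
open LaurentPolynomial

/-- The series `1 + Σ_{r,s≥1, r+s odd} (−1)^r T^{rs/2}(q^{(s−r−1)/2} − q^{(s−r+1)/2})`
in `ℤ[q,q⁻¹][[T]]`. -/
noncomputable def qSum : PowerSeries (LaurentPolynomial ℤ) :=
  PowerSeries.mk fun N =>
    if N = 0 then 1
    else
      ∑ p ∈ (Finset.range (2 * N + 1) ×ˢ Finset.range (2 * N + 1)).filter
          (fun p => 1 ≤ p.1 ∧ 1 ≤ p.2 ∧ ¬ Even (p.1 + p.2) ∧ p.1 * p.2 = 2 * N),
        ((-1 : LaurentPolynomial ℤ) ^ p.1) *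
          (LaurentPolynomial.T (((p.2 : ℤ) - (p.1 : ℤ) - 1) / 2) -
           LaurentPolynomial.T (((p.2 : ℤ) - (p.1 : ℤ) + 1) / 2))

/-- The normalised central ratio `[N]!² / ([N-n]! [N+n]!)` of `x`-factorials, where `i k` plays the
role of the inverse of `1 - x ^ k`. -/
def centralRatio {A : Type*} [CommRing A] (x : A) (i : ℕ → A) (N n : ℕ) : A :=
  ∏ j ∈ Finset.range n, (1 - x ^ (N - j)) * i (N + j + 1)

section FiniteIdentity

variable {A : Type*} [CommRing A] {x : A} {i : ℕ → A}

theorem centralRatio_succ_right (N n : ℕ) :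
    centralRatio x i N (n + 1) =
      centralRatio x i N n * ((1 - x ^ (N - n)) * i (N + n + 1)) := by
  simp [centralRatio, Finset.prod_range_succ]

theorem centralRatio_succ_left (hi : ∀ n, (1 - x ^ (n + 1)) * i (n + 1) = 1) (N n : ℕ) :
    centralRatio x i (N + 1) n * ((1 - x ^ (N + 1 - n)) * (1 - x ^ (N + 1 + n))) =
      centralRatio x i N n * (1 - x ^ (N + 1)) ^ 2 := by
  induction n with
  | zero => simp [centralRatio, sq]
  | succ n ih =>
    rw [centralRatio_succ_right, centralRatio_succ_right]
    have h1 := hi (N + n)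
    have h2 := hi (N + 1 + n)
    have e1 : N + 1 - (n + 1) = N - n := by omega
    have e2 : N + 1 + n = N + n + 1 := by omega
    have e3 : N + 1 + (n + 1) = N + 1 + n + 1 := by omega
    rw [e1, e3]
    rw [e2] at ih h2 ⊢
    linear_combination
      (centralRatio x i (N + 1) n * (1 - x ^ (N + 1 - n)) * (1 - x ^ (N - n))) * h2
      + (1 - x ^ (N - n)) * i (N + n + 1) * ih
      - (centralRatio x i (N + 1) n * (1 - x ^ (N + 1 - n)) * (1 - x ^ (N - n))) * h1

/-- Partial sums of the alternating sum of central `x`-binomial coefficients. -/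
theorem sum_centralRatio (hi : ∀ n, (1 - x ^ (n + 1)) * i (n + 1) = 1) (N k : ℕ) (hk : k ≤ N) :
    (1 - x ^ N) * (1 + ∑ n ∈ Finset.range k,
        (-1) ^ (n + 1) * x ^ (n * (n + 1) / 2) * (1 + x ^ (n + 1)) *
          centralRatio x i N (n + 1)) =
      (-1) ^ k * x ^ (k * (k + 1) / 2) * (1 - x ^ (N - k)) * centralRatio x i N k := by
  induction k with
  | zero => simp [centralRatio]
  | succ k ih =>
    rw [Finset.sum_range_succ, ← add_assoc, mul_add, ih (by omega), centralRatio_succ_right]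
    obtain ⟨t, rfl⟩ := Nat.exists_eq_add_of_le hk
    have h1 := hi (k + 1 + t + k)
    have e1 : k + 1 + t - k = t + 1 := by omega
    have e2 : k + 1 + t - (k + 1) = t := by omega
    have e3 : (k + 1) * (k + 1 + 1) / 2 = k * (k + 1) / 2 + (k + 1) := by
      rw [show (k + 1) * (k + 1 + 1) = k * (k + 1) + (k + 1) * 2 by ring,
        Nat.add_mul_div_right _ _ two_pos]
    rw [e1, e2, e3]
    linear_combination
      -((-1) ^ k * x ^ (k * (k + 1) / 2) * (1 - x ^ (t + 1)) * centralRatio x i (k + 1 + t) k) * h1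

theorem sum_centralRatio_self (hi : ∀ n, (1 - x ^ (n + 1)) * i (n + 1) = 1) (N : ℕ) :
    1 + ∑ n ∈ Finset.range (N + 1),
        (-1) ^ (n + 1) * x ^ (n * (n + 1) / 2) * (1 + x ^ (n + 1)) *
          centralRatio x i (N + 1) (n + 1) = 0 := by
  have h := sum_centralRatio hi (N + 1) (N + 1) le_rfl
  simp only [Nat.sub_self, pow_zero, sub_self, mul_zero, zero_mul] at h
  linear_combination i (N + 1) * h - (1 + ∑ n ∈ Finset.range (N + 1),
        (-1) ^ (n + 1) * x ^ (n * (n + 1) / 2) * (1 + x ^ (n + 1)) *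
          centralRatio x i (N + 1) (n + 1)) * hi N

/-- The partial fraction expansion of `∏ (1 - xⁿ)² / ((1 - q xⁿ) (1 - q' xⁿ))` for `q q' = 1`,
where `e n` plays the role of the inverse of `(1 - q xⁿ) (1 - q' xⁿ)`. -/
theorem prod_eq_prod_mul_sum_centralRatio {q q' : A} (hq : q * q' = 1) {e : ℕ → A}
    (hi : ∀ n, (1 - x ^ (n + 1)) * i (n + 1) = 1)
    (he : ∀ n, ((1 - q * x ^ (n + 1)) * (1 - q' * x ^ (n + 1))) * e (n + 1) = 1) (N : ℕ) :
    ∏ n ∈ Finset.range N, (1 - x ^ (n + 1)) ^ 2 =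
      (∏ n ∈ Finset.range N, ((1 - q * x ^ (n + 1)) * (1 - q' * x ^ (n + 1)))) *
        (1 + ∑ n ∈ Finset.range N, (-1) ^ (n + 1) * x ^ ((n + 1) * (n + 2) / 2) *
          (1 + x ^ (n + 1)) * ((1 - q) * (1 - q')) * e (n + 1) * centralRatio x i N (n + 1)) := by
  induction N with
  | zero => simp
  | succ N ih =>
    rw [Finset.prod_range_succ, ih, Finset.prod_range_succ, mul_assoc, mul_assoc]
    congr 1
    set D := (1 - q * x ^ (N + 1)) * (1 - q' * x ^ (N + 1)) with hD
    have key : ∀ n ∈ Finset.range (N + 1),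
        D * ((-1) ^ (n + 1) * x ^ ((n + 1) * (n + 2) / 2) *
          (1 + x ^ (n + 1)) * ((1 - q) * (1 - q')) * e (n + 1) *
            centralRatio x i (N + 1) (n + 1)) =
        (1 - x ^ (N + 1)) ^ 2 * ((-1) ^ (n + 1) * x ^ ((n + 1) * (n + 2) / 2) *
          (1 + x ^ (n + 1)) * ((1 - q) * (1 - q')) * e (n + 1) * centralRatio x i N (n + 1)) +
        x ^ (N + 1) * ((1 - q) * (1 - q')) *
          ((-1) ^ (n + 1) * x ^ (n * (n + 1) / 2) * (1 + x ^ (n + 1)) *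
            centralRatio x i (N + 1) (n + 1)) := by
      intro n hn
      obtain ⟨t, rfl⟩ := Nat.exists_eq_add_of_le (Nat.lt_succ_iff.mp (Finset.mem_range.mp hn))
      have h1 := centralRatio_succ_left hi (n + t) (n + 1)
      have e1 : n + t + 1 - (n + 1) = t := by omega
      have e3 : (n + 1) * (n + 2) / 2 = n * (n + 1) / 2 + (n + 1) := by
        rw [show (n + 1) * (n + 2) = n * (n + 1) + (n + 1) * 2 by ring,
          Nat.add_mul_div_right _ _ two_pos]
      rw [e1] at h1
      rw [e3, hD]
      have h2 : (1 - q * x ^ (n + t + 1)) * (1 - q' * x ^ (n + t + 1)) =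
          (1 - x ^ t) * (1 - x ^ (n + t + 1 + (n + 1))) +
            x ^ t * ((1 - q * x ^ (n + 1)) * (1 - q' * x ^ (n + 1))) := by
        linear_combination (x ^ (n + t + 1) * x ^ (n + t + 1) - x ^ t * x ^ (n + 1) * x ^ (n + 1))
          * hq
      rw [h2]
      linear_combination
        ((-1) ^ (n + 1) * x ^ (n * (n + 1) / 2 + (n + 1)) *
          (1 + x ^ (n + 1)) * ((1 - q) * (1 - q')) * e (n + 1)) * h1
        + ((-1) ^ (n + 1) * x ^ (n * (n + 1) / 2 + (n + 1)) * x ^ t *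
          (1 + x ^ (n + 1)) * ((1 - q) * (1 - q')) *
            centralRatio x i (n + t + 1) (n + 1)) * he n
    have hz : centralRatio x i N (N + 1) = 0 := by simp [centralRatio_succ_right]
    have h3 := sum_centralRatio_self hi N
    rw [mul_add, Finset.mul_sum, Finset.sum_congr rfl key, Finset.sum_add_distrib,
      ← Finset.mul_sum, ← Finset.mul_sum, Finset.sum_range_succ (n := N), hz, hD]
    linear_combination (-x ^ (N + 1) * ((1 - q) * (1 - q'))) * h3
      + (x ^ (N + 1) - x ^ (N + 1) * x ^ (N + 1)) * hq

end FiniteIdentity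

section Nilpotent

variable {A : Type*} [CommRing A] {x : A} {d : ℕ}

theorem pow_eq_zero_of_lt (hx : x ^ (d + 1) = 0) {k : ℕ} (hk : d < k) : x ^ k = 0 :=
  pow_eq_zero_of_le hk hx

theorem prod_range_eq_of_le {f : ℕ → A} (hf : ∀ n, d ≤ n → f n = 1) {m : ℕ} (hm : d ≤ m) :
    ∏ n ∈ Finset.range m, f n = ∏ n ∈ Finset.range d, f n := by
  symm
  refine Finset.prod_subset (Finset.range_subset_range.mpr hm) fun n _ hn => hf n ?_
  simpa using hn

theorem one_sub_mul_geom (hx : x ^ (d + 1) = 0) (q : A) (n : ℕ) :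
    (1 - q * x ^ (n + 1)) * ∑ k ∈ Finset.range (d + 1), (q * x ^ (n + 1)) ^ k = 1 := by
  rw [mul_neg_geom_sum, mul_pow, ← pow_mul, pow_eq_zero_of_lt hx (by nlinarith)]
  simp

/-- The product identity modulo `x ^ (d + 1)`. -/
theorem prod_eq_prod_mul_sum_of_pow_eq_zero (hx : x ^ (d + 1) = 0) {q q' : A} (hq : q * q' = 1)
    {m : ℕ} (hm : d ≤ m) :
    ∏ n ∈ Finset.range m, (1 - x ^ (n + 1)) ^ 2 =
      (∏ n ∈ Finset.range m, ((1 - q * x ^ (n + 1)) * (1 - q' * x ^ (n + 1)))) *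
        (1 + ∑ n ∈ Finset.range (2 * d), ∑ k ∈ Finset.range (d + 1),
          (-1) ^ (n + 1) * ((1 - q) * (q ^ k - q' ^ (k + 1))) *
            x ^ ((n + 1) * (n + 2) / 2 + (n + 1) * k)) := by
  have hx' : ∀ n, d ≤ n → x ^ (n + 1) = 0 := fun n hn => pow_eq_zero_of_lt hx (by omega)
  rw [prod_range_eq_of_le (d := d) (fun n hn => by simp [hx' n hn]) hm,
    prod_range_eq_of_le (d := d) (f := fun n => (1 - q * x ^ (n + 1)) * (1 - q' * x ^ (n + 1)))
      (fun n hn => by simp [hx' n hn]) hm]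
  have h2 : d ≤ 2 * d := by omega
  rw [← prod_range_eq_of_le (d := d) (fun n hn => by simp [hx' n hn]) h2,
    ← prod_range_eq_of_le (d := d) (f := fun n => (1 - q * x ^ (n + 1)) * (1 - q' * x ^ (n + 1)))
      (fun n hn => by simp [hx' n hn]) h2]
  set G : A → ℕ → A := fun y n => ∑ k ∈ Finset.range (d + 1), (y * x ^ n) ^ k with hG
  have hGm : ∀ y n, (1 - y * x ^ (n + 1)) * G y (n + 1) = 1 := fun y n => one_sub_mul_geom hx y n
  have hi : ∀ n, (1 - x ^ (n + 1)) * G 1 (n + 1) = 1 := fun n => by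
    simpa using hGm 1 n
  rw [prod_eq_prod_mul_sum_centralRatio hq hi (e := fun n => G q n * G q' n)
    (fun n => by linear_combination (1 - q' * x ^ (n + 1)) * G q' (n + 1) * hGm q n + hGm q' n)]
  congr 2
  refine Finset.sum_congr rfl fun n _ => ?_
  have hc : x ^ ((n + 1) * (n + 2) / 2) * centralRatio x (G 1) (2 * d) (n + 1) =
      x ^ ((n + 1) * (n + 2) / 2) := by
    rcases lt_or_ge d (n + 1) with hn | hn
    · have : n + 1 ≤ (n + 1) * (n + 2) / 2 := by
        rw [Nat.le_div_iff_mul_le two_pos]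
        nlinarith
      rw [pow_eq_zero_of_lt hx (by omega), zero_mul]
    · have : centralRatio x (G 1) (2 * d) (n + 1) = 1 := by
        refine Finset.prod_eq_one fun j hj => ?_
        have hj' := Finset.mem_range.mp hj
        have h := hi (2 * d + j)
        rw [hx' _ (by omega), sub_zero, one_mul] at h
        rw [h, pow_eq_zero_of_lt hx (by omega)]
        simp
      rw [this, mul_one]
  have hw : (1 + x ^ (n + 1)) * (1 - q') * (G q (n + 1) * G q' (n + 1)) =
      G q (n + 1) - q' * G q' (n + 1) := by
    linear_combination (-q' * G q' (n + 1)) * hGm q n + G q (n + 1) * hGm q' n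
      - x ^ (n + 1) * G q (n + 1) * G q' (n + 1) * hq
  have hs : ∑ k ∈ Finset.range (d + 1), (-1) ^ (n + 1) * ((1 - q) * (q ^ k - q' ^ (k + 1))) *
        x ^ ((n + 1) * (n + 2) / 2 + (n + 1) * k) =
      (-1) ^ (n + 1) * x ^ ((n + 1) * (n + 2) / 2) * (1 - q) *
        (G q (n + 1) - q' * G q' (n + 1)) := by
    simp only [hG, Finset.mul_sum, ← Finset.sum_sub_distrib]
    refine Finset.sum_congr rfl fun k _ => ?_
    rw [mul_pow, mul_pow, ← pow_mul]
    ring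
  rw [hs, ← hw]
  linear_combination ((-1) ^ (n + 1) * (1 + x ^ (n + 1)) * ((1 - q) * (1 - q')) *
    (G q (n + 1) * G q' (n + 1))) * hc

end Nilpotent

theorem half_exponent_eq_iff (n k N : ℕ) :
    (n + 1) * (n + 2) / 2 + (n + 1) * k = N ↔ (n + 1) * (n + 2 + 2 * k) = 2 * N := by
  have h : 2 ∣ (n + 1) * (n + 2) := (Nat.even_mul_succ_self (n + 1)).two_dvd
  have h' : (n + 1) * (n + 2 + 2 * k) = (n + 1) * (n + 2) + 2 * ((n + 1) * k) := by ring
  omega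

theorem coeff_qSum_eq {d N : ℕ} (hN : N ≤ d) :
    PowerSeries.coeff N qSum =
      PowerSeries.coeff N (1 + ∑ n ∈ Finset.range (2 * d), ∑ k ∈ Finset.range (d + 1),
          PowerSeries.C ((-1 : LaurentPolynomial ℤ) ^ (n + 1) *
            ((1 - LaurentPolynomial.T 1) *
              (LaurentPolynomial.T 1 ^ k - LaurentPolynomial.T (-1) ^ (k + 1)))) *
            PowerSeries.X ^ ((n + 1) * (n + 2) / 2 + (n + 1) * k)) := by
  simp only [map_add, map_sum, PowerSeries.coeff_C_mul_X_pow, PowerSeries.coeff_one]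
  rw [qSum, PowerSeries.coeff_mk]
  rcases Nat.eq_zero_or_pos N with rfl | hpos
  · rw [if_pos rfl, if_pos rfl, Finset.sum_eq_zero, add_zero]
    intro n _
    refine Finset.sum_eq_zero fun k _ => if_neg fun h => ?_
    have := (half_exponent_eq_iff n k 0).mp h.symm
    simp at this
  rw [if_neg hpos.ne', if_neg hpos.ne', zero_add, ← Finset.sum_product', ← Finset.sum_filter]
  set I := (Finset.range (2 * d) ×ˢ Finset.range (d + 1)).filter
    (fun a => N = (a.1 + 1) * (a.1 + 2) / 2 + (a.1 + 1) * a.2) with hI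
  have memI : ∀ n k : ℕ, (n, k) ∈ I ↔ (n + 1) * (n + 2 + 2 * k) = 2 * N := by
    intro n k
    rw [hI, Finset.mem_filter, Finset.mem_product, Finset.mem_range, Finset.mem_range,
      ← half_exponent_eq_iff]
    refine ⟨fun h => h.2.symm, fun h => ⟨?_, h.symm⟩⟩
    have h' := (half_exponent_eq_iff n k N).mp h
    constructor
    · nlinarith
    · nlinarith
  have hterm : ∀ a ∈ I, (-1 : LaurentPolynomial ℤ) ^ (a.1 + 1) *
        ((1 - LaurentPolynomial.T 1) *
          (LaurentPolynomial.T 1 ^ a.2 - LaurentPolynomial.T (-1) ^ (a.2 + 1))) =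
      (-1) ^ (a.1 + 1) * (LaurentPolynomial.T (a.2 : ℤ) - LaurentPolynomial.T ((a.2 : ℤ) + 1)) +
      (-1) ^ a.1 * (LaurentPolynomial.T (-(a.2 : ℤ) - 1) - LaurentPolynomial.T (-(a.2 : ℤ))) := by
    intro a _
    have h1 : LaurentPolynomial.T 1 * LaurentPolynomial.T (-(a.2 : ℤ) - 1) =
        (LaurentPolynomial.T (-(a.2 : ℤ)) : LaurentPolynomial ℤ) := by
      rw [← LaurentPolynomial.T_add]; congr 1; ring
    have h2 : ((a.2 + 1 : ℕ) : ℤ) * -1 = -(a.2 : ℤ) - 1 := by push_cast; ring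
    rw [LaurentPolynomial.T_pow, LaurentPolynomial.T_pow, h2, mul_one,
      LaurentPolynomial.T_add (a.2 : ℤ) 1]
    linear_combination (-1 : LaurentPolynomial ℤ) ^ (a.1 + 1) * h1
  rw [Finset.sum_congr rfl hterm, Finset.sum_add_distrib,
    ← Finset.sum_filter_add_sum_filter_not _ (fun p : ℕ × ℕ => p.1 < p.2)]
  congr 1
  · refine Finset.sum_nbij' (fun p => (p.1 - 1, (p.2 - p.1 - 1) / 2))
      (fun a => (a.1 + 1, a.1 + 2 + 2 * a.2)) ?_ ?_ ?_ ?_ ?_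
    · rintro ⟨r, s⟩ h
      simp only [Finset.mem_filter, Nat.even_iff] at h
      obtain ⟨⟨-, h1, h2, h3, h4⟩, h5⟩ := h
      rw [memI, ← h4]
      congr 1 <;> omega
    · rintro ⟨n, k⟩ h
      rw [memI] at h
      simp only [Finset.mem_filter, Finset.mem_product, Finset.mem_range, Nat.even_iff]
      refine ⟨⟨⟨?_, ?_⟩, ?_, ?_, ?_, h⟩, ?_⟩
      · nlinarith
      · nlinarith
      all_goals omega
    · rintro ⟨r, s⟩ h
      simp only [Finset.mem_filter, Nat.even_iff] at h
      ext <;> simp only <;> omega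
    · rintro ⟨n, k⟩ h
      ext <;> simp only <;> omega
    · rintro ⟨r, s⟩ h
      simp only [Finset.mem_filter, Nat.even_iff] at h
      have e0 : r - 1 + 1 = r := by omega
      have e1 : ((s : ℤ) - r - 1) / 2 = (((s - r - 1) / 2 : ℕ) : ℤ) := by omega
      have e2 : ((s : ℤ) - r + 1) / 2 = (((s - r - 1) / 2 : ℕ) : ℤ) + 1 := by omega
      simp only [e0, e1, e2]
  · refine Finset.sum_nbij' (fun p => (p.2 - 1, (p.1 - p.2 - 1) / 2))
      (fun a => (a.1 + 2 + 2 * a.2, a.1 + 1)) ?_ ?_ ?_ ?_ ?_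
    · rintro ⟨r, s⟩ h
      simp only [Finset.mem_filter, Nat.even_iff] at h
      obtain ⟨⟨-, h1, h2, h3, h4⟩, h5⟩ := h
      rw [memI, ← h4, mul_comm r s]
      congr 1 <;> omega
    · rintro ⟨n, k⟩ h
      rw [memI] at h
      simp only [Finset.mem_filter, Finset.mem_product, Finset.mem_range, Nat.even_iff]
      refine ⟨⟨⟨?_, ?_⟩, ?_, ?_, ?_, by rw [mul_comm]; exact h⟩, ?_⟩
      · nlinarith
      · nlinarith
      all_goals omega
    · rintro ⟨r, s⟩ h
      simp only [Finset.mem_filter, Nat.even_iff] at h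
      ext <;> simp only <;> omega
    · rintro ⟨n, k⟩ h
      ext <;> simp only <;> omega
    · rintro ⟨r, s⟩ h
      simp only [Finset.mem_filter, Nat.even_iff] at h
      have e0 : r = s - 1 + 2 * ((r - s - 1) / 2 + 1) := by omega
      have e1 : ((s : ℤ) - r - 1) / 2 = -(((r - s - 1) / 2 : ℕ) : ℤ) - 1 := by omega
      have e2 : ((s : ℤ) - r + 1) / 2 = -(((r - s - 1) / 2 : ℕ) : ℤ) := by omega
      have e3 : (-1 : LaurentPolynomial ℤ) ^ r = (-1) ^ (s - 1) := by
        conv_lhs => rw [e0]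
        rw [pow_add, pow_mul]
        simp
      simp only [e1, e2, e3]

/-- The identity
`∏_{n≥1}(1−Tⁿ)² = (∏_{n≥1}(1−qTⁿ)(1−q⁻¹Tⁿ))·(1 + Σ_{r,s≥1, r+s odd} (−1)^r T^{rs/2}(q^{(s−r−1)/2}−q^{(s−r+1)/2}))`
in `ℤ[q,q⁻¹][[T]]`, with infinite products taken in the T-adic (coefficientwise)
topology: each `T`-coefficient of the two sides agrees once the partial products
include all factors of index up to that degree. -/
theorem stmt_16 :
    ∀ d m : ℕ, d ≤ m →
      PowerSeries.coeff (R := LaurentPolynomial ℤ) d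
        (∏ n ∈ Finset.range m,
          (1 - (PowerSeries.X : PowerSeries (LaurentPolynomial ℤ)) ^ (n + 1)) ^ 2) =
      PowerSeries.coeff (R := LaurentPolynomial ℤ) d
        ((∏ n ∈ Finset.range m,
            ((1 - PowerSeries.C (R := LaurentPolynomial ℤ) (LaurentPolynomial.T 1) *
                PowerSeries.X ^ (n + 1)) *
             (1 - PowerSeries.C (R := LaurentPolynomial ℤ) (LaurentPolynomial.T (-1)) *
                PowerSeries.X ^ (n + 1)))) * qSum) := by
  intro d m hdm
  set π := Ideal.Quotient.mk
    (Ideal.span {(PowerSeries.X : PowerSeries (LaurentPolynomial ℤ)) ^ (d + 1)}) with hπ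
  have hdvd : ∀ f g : PowerSeries (LaurentPolynomial ℤ), π f = π g ↔
      ∀ N ≤ d, PowerSeries.coeff N f = PowerSeries.coeff N g := by
    intro f g
    rw [hπ, Ideal.Quotient.eq, Ideal.mem_span_singleton, PowerSeries.X_pow_dvd_iff]
    simp only [map_sub, sub_eq_zero, Nat.lt_succ_iff]
  refine (hdvd _ _).mp ?_ d le_rfl
  have hx : π PowerSeries.X ^ (d + 1) = 0 := by
    rw [← map_pow, hπ, Ideal.Quotient.eq_zero_iff_mem]
    exact Ideal.mem_span_singleton_self _
  have hq : π (PowerSeries.C (LaurentPolynomial.T 1)) *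
      π (PowerSeries.C (LaurentPolynomial.T (-1))) = 1 := by
    rw [← map_mul, ← map_mul, ← LaurentPolynomial.T_add]
    simp
  rw [map_mul, (hdvd _ _).mpr fun N hN => coeff_qSum_eq hN]
  simpa only [map_prod, map_sum, map_add, map_sub, map_mul, map_pow, map_one, map_neg] using
    prod_eq_prod_mul_sum_of_pow_eq_zero hx hq hdm
end
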